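/- arXiv:0911.4003 — 3 statements merged into one kernel-verified Lean document; each statement's English description precedes it below -/
import Mathlib

section
/- In a countable network Δ in which d⁻_c(x) < ∞ for every vertex x (the sum of capacities of edges into x is finite), there exists a flow f attaining the supremum of the values of all flows, and moreover satisfying d⁻_f(x) ≤ |f| for every vertex x. In particular, if flow values are unbounded, there is a flow of infinite value. -/
open scoped ENNReal NNReal Classical

/-- A network: a loopless digraph with edge set `E` on vertex type `V`,
capacity function `c`, source `s` (no in-edges) and sink `t` (no out-edges). -/
structure Network (V : Type) where
  E : Set (V × V)
  loopless : ∀ v, (v, v) ∉ E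
  c : V × V → ℝ≥0
  s : V
  t : V
  ne : s ≠ t
  no_in_s : ∀ v, (v, s) ∉ E
  no_out_t : ∀ v, (t, v) ∉ E

variable {V : Type}

/-- Out-degree of `f` at `x`: sum of `f` over edges leaving `x`. -/
noncomputable def dplus (f : V × V → ℝ≥0) (x : V) : ℝ≥0∞ := ∑' v, (f (x, v) : ℝ≥0∞)

/-- In-degree of `f` at `x`: sum of `f` over edges entering `x`. -/
noncomputable def dminus (f : V × V → ℝ≥0) (x : V) : ℝ≥0∞ := ∑' v, (f (v, x) : ℝ≥0∞)

/-- A flow: nonnegative, supported on the edges, below capacity, Kirchhoff away from s,t. -/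
structure IsFlow (N : Network V) (f : V × V → ℝ≥0) : Prop where
  supp : ∀ e, e ∉ N.E → f e = 0
  cap : ∀ e, f e ≤ N.c e
  kirchhoff : ∀ x, x ≠ N.s → x ≠ N.t → dplus f x = dminus f x

noncomputable def flowValue (N : Network V) (f : V × V → ℝ≥0) : ℝ≥0∞ := dplus f N.s

/-- An s–t cut, given by its vertex side `S`. -/
def IsCut (N : Network V) (S : Set V) : Prop := N.s ∈ S ∧ N.t ∉ S

/-- The edges of the cut `E(S, V∖S)`. -/
def cutEdges (N : Network V) (S : Set V) : Set (V × V) := {e ∈ N.E | e.1 ∈ S ∧ e.2 ∉ S}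

noncomputable def cutCap (N : Network V) (S : Set V) : ℝ≥0∞ :=
  ∑' e : cutEdges N S, (N.c e : ℝ≥0∞)

noncomputable def cutFlow (N : Network V) (f : V × V → ℝ≥0) (S : Set V) : ℝ≥0∞ :=
  ∑' e : cutEdges N S, (f e : ℝ≥0∞)

/-- `f` saturates the cut `E(S,V∖S)` and vanishes on the reverse cut `E(V∖S,S)`. -/
def Orthogonal (N : Network V) (f : V × V → ℝ≥0) (S : Set V) : Prop :=
  (∀ e ∈ cutEdges N S, f e = N.c e) ∧ (∀ e ∈ cutEdges N Sᶜ, f e = 0)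

/-- A weighted web. -/
structure Web (V : Type) where
  D : Set (V × V)
  A : Set V
  B : Set V
  w : V → ℝ≥0

def IsWalk (E : Set (V × V)) (p : List V) : Prop := p.Chain' (fun a b => (a, b) ∈ E)

/-- A (finite, directed) path/walk from `A` to `B` in the digraph with edge set `E`. -/
def IsABPath (E : Set (V × V)) (A B : Set V) (p : List V) : Prop :=
  IsWalk E p ∧ (∃ a ∈ A, p.head? = some a) ∧ (∃ b ∈ B, p.getLast? = some b)

/-- `S` is `A`–`B`-separating in the web `W`. -/
def Separates (W : Web V) (S : Set V) : Prop :=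
  ∀ p : List V, IsABPath W.D W.A W.B p → ∃ x ∈ S, x ∈ p

/-- A current in a weighted web. -/
structure IsCurrent (W : Web V) (f : V × V → ℝ≥0) : Prop where
  supp : ∀ e, e ∉ W.D → f e = 0
  out_le : ∀ x, dplus f x ≤ (W.w x : ℝ≥0∞)
  in_le : ∀ x, dminus f x ≤ (W.w x : ℝ≥0∞)
  flow_ineq : ∀ x, x ∉ W.A → dplus f x ≤ dminus f x
  a_in : ∀ a ∈ W.A, dminus f a = 0
  b_out : ∀ b ∈ W.B, dplus f b = 0

def SAT (W : Web V) (f : V × V → ℝ≥0) : Set V :=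
  {x | x ∈ W.A ∨ dminus f x = (W.w x : ℝ≥0∞)}

def SINK (f : V × V → ℝ≥0) : Set V := {x | dplus f x = 0}

def TER (W : Web V) (f : V × V → ℝ≥0) : Set V := SAT W f ∩ SINK f

/-- The set of vertices separated ("roofed") from `B` by `S`. -/
def RF (W : Web V) (S : Set V) : Set V :=
  {v | ∀ p : List V, IsABPath W.D {v} W.B p → ∃ x ∈ S, x ∈ p}

/-- The essential vertices of `S`: those `x ∈ S` not separated from `B` by `S∖{x}`. -/
def Essential (W : Web V) (S : Set V) : Set V :=
  {x ∈ S | ∃ p : List V, IsABPath W.D {x} W.B p ∧ ∀ y ∈ p, y ∈ S → y = x}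

def RFo (W : Web V) (S : Set V) : Set V := RF W S \ Essential W S

/-- A wave: a current whose terminal set separates, sending no flow outside `RF(TER f)`. -/
def IsWave (W : Web V) (f : V × V → ℝ≥0) : Prop :=
  IsCurrent W f ∧ Separates W (TER W f) ∧ ∀ x, x ∉ RF W (TER W f) → dplus f x = 0

def Bipartite (W : Web V) : Prop :=
  (∀ v : V, v ∈ W.A ∪ W.B) ∧ ∀ e ∈ W.D, e.1 ∈ W.A ∧ e.2 ∈ W.B

def IsHindrance (W : Web V) (f : V × V → ℝ≥0) : Prop :=
  IsWave W f ∧ ∃ a ∈ W.A, a ∉ Essential W (TER W f) ∧ dplus f a < (W.w a : ℝ≥0∞)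

def Hindered (W : Web V) : Prop := ∃ f, IsHindrance W f

def Loose (W : Web V) : Prop :=
  (∀ f, IsWave W f → ∀ e, f e = 0) ∧ ¬ IsHindrance W (fun _ => 0)

/-- A web-flow: a current satisfying Kirchhoff's law outside `A ∪ B`. -/
def IsWebFlow (W : Web V) (f : V × V → ℝ≥0) : Prop :=
  IsCurrent W f ∧ ∀ x, x ∉ W.A ∪ W.B → dplus f x = dminus f x

/-- The quotient web `Γ/f`. -/
def quotWeb (W : Web V) (f : V × V → ℝ≥0) : Web V where
  D := {e ∈ W.D | e.1 ∉ RFo W (TER W f) ∧ e.2 ∉ RFo W (TER W f)}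
  A := Essential W (TER W f)
  B := W.B
  w := W.w

/-- `f ↷ g`: `f` plus the restriction of `g` to the edges of `Γ/f`. -/
noncomputable def hetz (W : Web V) (f g : V × V → ℝ≥0) : V × V → ℝ≥0 :=
  fun e => f e + if e ∈ (quotWeb W f).D then g e else 0

/-- The residual network `RES(Δ,f)`. -/
noncomputable def resNetwork (N : Network V) (f : V × V → ℝ≥0) : Network V where
  E := N.E ∪ {e | (e.2, e.1) ∈ N.E ∧ e.2 ≠ N.s ∧ e.1 ≠ N.t}
  loopless := fun v hv => hv.elim (N.loopless v) (fun h => N.loopless v h.1)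
  c := fun e => if e ∈ N.E then N.c e - f e else f (e.2, e.1)
  s := N.s
  t := N.t
  ne := N.ne
  no_in_s := fun v hv => hv.elim (N.no_in_s v) (fun h => h.2.1 rfl)
  no_out_t := fun v hv => hv.elim (N.no_out_t v) (fun h => h.2.2 rfl)

/-- `f ⊕ g`, for `g` a flow in the residual network. -/
noncomputable def oplus (N : Network V) (f g : V × V → ℝ≥0) : V × V → ℝ≥0 :=
  fun e => if e ∈ N.E then f e + g e - g (e.2, e.1) else 0

/-- A finite directed s–t path. -/
def IsSTPath (N : Network V) (p : List V) : Prop :=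
  IsWalk N.E p ∧ p.head? = some N.s ∧ p.getLast? = some N.t ∧ p.Nodup

/-- A mundane flow: a nonnegative combination of (characteristic functions of) s–t paths. -/
def IsMundane (N : Network V) (f : V × V → ℝ≥0) : Prop :=
  ∃ (ι : Type) (θ : ι → ℝ≥0) (P : ι → List V),
    (∀ i, 0 < θ i) ∧ (∀ i, IsSTPath N (P i)) ∧
    ∀ e : V × V, (f e : ℝ≥0∞) = ∑' i, if e ∈ (P i).zip (P i).tail then (θ i : ℝ≥0∞) else 0

def NetLocallyFinite (N : Network V) : Prop :=
  ∀ v : V, {e ∈ N.E | e.1 = v ∨ e.2 = v}.Finite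

/-- A finite-cut-respecting flow. -/
def IsFCR (N : Network V) (f : V × V → ℝ≥0) : Prop :=
  IsFlow N f ∧ ∀ S : Set V, N.s ∈ S → (cutEdges N S).Finite →
    (N.t ∈ S → cutFlow N f S = cutFlow N f Sᶜ) ∧
    (N.t ∉ S → cutFlow N f S = cutFlow N f Sᶜ + flowValue N f)

/-- A cut-respecting flow. -/
def IsCR (N : Network V) (f : V × V → ℝ≥0) : Prop :=
  IsFCR N f ∧ ∀ S : Set V, IsCut N S →
    flowValue N f + cutFlow N f Sᶜ ≤ cutCap N S ∧
    cutFlow N f S ≤ cutCap N Sᶜ + flowValue N f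

noncomputable def outSum (h : V × V → ℝ) (x : V) : ℝ := ∑' y, h (x, y)

noncomputable def inSum (h : V × V → ℝ) (x : V) : ℝ := ∑' y, h (y, x)

/-- All in- and out-sums of `q` converge. -/
structure LocSummable (q : V × V → ℝ) : Prop where
  out : ∀ x, Summable fun y => q (x, y)
  inn : ∀ x, Summable fun y => q (y, x)

theorem LocSummable.of_le {q h : V × V → ℝ} (hq : LocSummable q) (h0 : 0 ≤ h) (hh : h ≤ q) :
    LocSummable h :=
  ⟨fun x => (hq.out x).of_nonneg_of_le (fun _ => h0 _) (fun _ => hh _),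
    fun x => (hq.inn x).of_nonneg_of_le (fun _ => h0 _) (fun _ => hh _)⟩

theorem LocSummable.sub {q h : V × V → ℝ} (hq : LocSummable q) (hh : LocSummable h) :
    LocSummable (q - h) :=
  ⟨fun x => (hq.out x).sub (hh.out x), fun x => (hq.inn x).sub (hh.inn x)⟩

theorem LocSummable.add {q h : V × V → ℝ} (hq : LocSummable q) (hh : LocSummable h) :
    LocSummable (q + h) :=
  ⟨fun x => (hq.out x).add (hh.out x), fun x => (hq.inn x).add (hh.inn x)⟩

theorem LocSummable.smul {q : V × V → ℝ} (hq : LocSummable q) (a : ℝ) :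
    LocSummable (a • q) :=
  ⟨fun x => (hq.out x).mul_left a, fun x => (hq.inn x).mul_left a⟩

theorem outSum_sub {q h : V × V → ℝ} (hq : LocSummable q) (hh : LocSummable h) (x : V) :
    outSum (q - h) x = outSum q x - outSum h x :=
  (hq.out x).tsum_sub (hh.out x)

theorem inSum_sub {q h : V × V → ℝ} (hq : LocSummable q) (hh : LocSummable h) (x : V) :
    inSum (q - h) x = inSum q x - inSum h x :=
  (hq.inn x).tsum_sub (hh.inn x)

theorem outSum_add {q h : V × V → ℝ} (hq : LocSummable q) (hh : LocSummable h) (x : V) :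
    outSum (q + h) x = outSum q x + outSum h x :=
  (hq.out x).tsum_add (hh.out x)

theorem inSum_add {q h : V × V → ℝ} (hq : LocSummable q) (hh : LocSummable h) (x : V) :
    inSum (q + h) x = inSum q x + inSum h x :=
  (hq.inn x).tsum_add (hh.inn x)

theorem outSum_smul (a : ℝ) (q : V × V → ℝ) (x : V) : outSum (a • q) x = a * outSum q x :=
  tsum_mul_left

theorem inSum_smul (a : ℝ) (q : V × V → ℝ) (x : V) : inSum (a • q) x = a * inSum q x :=
  tsum_mul_left

theorem locSummable_single (e : V × V) (a : ℝ) : LocSummable (Pi.single e a) := by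
  constructor
  · intro x
    refine summable_of_ne_finset_zero (s := {e.2}) fun y hy => ?_
    simp only [Finset.mem_singleton] at hy
    exact Pi.single_eq_of_ne (fun h => hy (by rw [← h])) _
  · intro x
    refine summable_of_ne_finset_zero (s := {e.1}) fun y hy => ?_
    simp only [Finset.mem_singleton] at hy
    exact Pi.single_eq_of_ne (fun h => hy (by rw [← h])) _

theorem outSum_single (u v : V) (a : ℝ) (x : V) :
    outSum (Pi.single (u, v) a) x = if x = u then a else 0 := by
  unfold outSum
  rw [tsum_eq_single v]
  · by_cases h : x = u
    · simp [h]
    · simp [h]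
  · intro y hy
    exact Pi.single_eq_of_ne (fun h => hy (Prod.ext_iff.1 h).2) _

theorem inSum_single (u v : V) (a : ℝ) (x : V) :
    inSum (Pi.single (u, v) a) x = if x = v then a else 0 := by
  unfold inSum
  rw [tsum_eq_single u]
  · by_cases h : x = v
    · simp [h]
    · simp [h]
  · intro y hy
    exact Pi.single_eq_of_ne (fun h => hy (Prod.ext_iff.1 h).1) _

theorem continuousOn_outSum {q : V × V → ℝ} (hq : LocSummable q) (x : V) :
    ContinuousOn (fun h => outSum h x) (Set.Icc 0 q) := by
  refine continuousOn_tsum (u := fun y => q (x, y))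
    (fun y => (continuous_apply _).continuousOn) (hq.out x) fun y h hh => ?_
  rw [Real.norm_of_nonneg (hh.1 _)]
  exact hh.2 _

theorem continuousOn_inSum {q : V × V → ℝ} (hq : LocSummable q) (x : V) :
    ContinuousOn (fun h => inSum h x) (Set.Icc 0 q) := by
  refine continuousOn_tsum (u := fun y => q (y, x))
    (fun y => (continuous_apply _).continuousOn) (hq.inn x) fun y h hh => ?_
  rw [Real.norm_of_nonneg (hh.1 _)]
  exact hh.2 _

theorem summable_ite_mem {g : V → ℝ} (hg : Summable g) (S : Finset V) :
    Summable fun z => if z ∈ S then 0 else g z := by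
  have : (fun z => if z ∈ S then 0 else g z) = Set.indicator {z | z ∉ S} g := by
    ext z
    by_cases h : z ∈ S <;> simp [h]
  rw [this]
  exact hg.indicator _

theorem tsum_eq_sum_add_tsum_ite_mem {g : V → ℝ} (hg : Summable g) (S : Finset V) :
    ∑' z, g z = ∑ z ∈ S, g z + ∑' z, if z ∈ S then 0 else g z := by
  have h1 : ∑' z, (if z ∈ S then g z else 0) = ∑ z ∈ S, g z := by
    rw [tsum_eq_sum (s := S) (fun z hz => if_neg hz)]
    exact Finset.sum_congr rfl fun z hz => if_pos hz
  have hs : Summable fun z => if z ∈ S then g z else 0 :=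
    summable_of_ne_finset_zero (s := S) fun z hz => if_neg hz
  rw [← h1, ← hs.tsum_add (summable_ite_mem hg S)]
  refine tsum_congr fun z => ?_
  by_cases h : z ∈ S <;> simp [h]

noncomputable def setOutflow (h : V × V → ℝ) (S : Finset V) : ℝ :=
  ∑ y ∈ S, ∑' z, if z ∈ S then 0 else h (y, z)

noncomputable def setInflow (h : V × V → ℝ) (S : Finset V) : ℝ :=
  ∑ y ∈ S, ∑' z, if z ∈ S then 0 else h (z, y)

theorem setOutflow_sub_setInflow {h : V × V → ℝ} (hh : LocSummable h) (S : Finset V) :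
    ∑ y ∈ S, (outSum h y - inSum h y) = setOutflow h S - setInflow h S := by
  have h1 : ∑ y ∈ S, outSum h y = ∑ y ∈ S, ∑ z ∈ S, h (y, z) + setOutflow h S := by
    rw [setOutflow, ← Finset.sum_add_distrib]
    exact Finset.sum_congr rfl fun y _ => tsum_eq_sum_add_tsum_ite_mem (hh.out y) S
  have h2 : ∑ y ∈ S, inSum h y = ∑ y ∈ S, ∑ z ∈ S, h (z, y) + setInflow h S := by
    rw [setInflow, ← Finset.sum_add_distrib]
    exact Finset.sum_congr rfl fun y _ => tsum_eq_sum_add_tsum_ite_mem (hh.inn y) S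
  rw [Finset.sum_sub_distrib, h1, h2, Finset.sum_comm]
  ring

/-- A walk along edges of positive `h`-value, weighted by a small number and staying below `h`,
with a prescribed positive last edge. -/
theorem exists_subwalk {h : V × V → ℝ} (h0 : 0 ≤ h) (hh : LocSummable h) {a y b : V}
    (hr : Relation.ReflTransGen (fun u v => 0 < h (u, v)) a y) (hb : 0 < h (y, b)) :
    ∃ k ∈ Set.Icc 0 h, ∃ ε : ℝ, 0 < k (y, b) ∧
      ∀ v, outSum k v - inSum k v = (if v = a then ε else 0) - if v = b then ε else 0 := by
  have extend : ∀ (y b : V), 0 < h (y, b) → (∃ k ∈ Set.Icc 0 h, ∃ ε : ℝ, 0 < ε ∧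
      ∀ v, outSum k v - inSum k v = (if v = a then ε else 0) - if v = y then ε else 0) →
      ∃ k ∈ Set.Icc 0 h, ∃ ε : ℝ, 0 < ε ∧ 0 < k (y, b) ∧
      ∀ v, outSum k v - inSum k v = (if v = a then ε else 0) - if v = b then ε else 0 := by
    rintro y b hb ⟨k, hk, ε, hε, hnet⟩
    set η := min ε (h (y, b)) with hη
    have hη0 : 0 < η := lt_min hε hb
    have hr0 : 0 ≤ η / (2 * ε) := by positivity
    have hr1 : η / (2 * ε) ≤ 1 / 2 := by
      rw [div_le_div_iff₀ (by positivity) (by norm_num)]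
      have := min_le_left ε (h (y, b))
      linarith
    have hls := hh.of_le hk.1 hk.2
    refine ⟨(η / (2 * ε)) • k + Pi.single (y, b) (η / 2), ⟨fun e => ?_, fun e => ?_⟩, η / 2,
      by positivity, ?_, fun v => ?_⟩
    · have h1 : 0 ≤ k e := hk.1 e
      have h2 : 0 ≤ (Pi.single (y, b) (η / 2) : V × V → ℝ) e := by
        rw [Pi.single_apply]
        split_ifs <;> positivity
      have := mul_nonneg hr0 h1
      simp only [Pi.zero_apply, Pi.add_apply, Pi.smul_apply, smul_eq_mul]
      linarith
    · have h1 : 0 ≤ k e := hk.1 e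
      have h1' : k e ≤ h e := hk.2 e
      have h3 := mul_le_mul_of_nonneg_right hr1 h1
      have h2 : (Pi.single (y, b) (η / 2) : V × V → ℝ) e ≤ h e / 2 := by
        rw [Pi.single_apply]
        split_ifs with he
        · rw [he]
          have := min_le_right ε (h (y, b))
          linarith
        · have : 0 ≤ h e := h0 e
          linarith
      simp only [Pi.add_apply, Pi.smul_apply, smul_eq_mul]
      linarith
    · have h1 : 0 ≤ k (y, b) := hk.1 _
      have := mul_nonneg hr0 h1
      simp only [Pi.add_apply, Pi.smul_apply, smul_eq_mul, Pi.single_eq_same]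
      linarith
    · rw [outSum_add (hls.smul _) (locSummable_single _ _),
        inSum_add (hls.smul _) (locSummable_single _ _), outSum_smul, inSum_smul,
        outSum_single, inSum_single]
      have h4 : η / (2 * ε) * ε = η / 2 := by field_simp
      have h5 : η / (2 * ε) * (outSum k v - inSum k v)
          = (if v = a then η / 2 else 0) - if v = y then η / 2 else 0 := by
        rw [hnet v, mul_sub, mul_ite, mul_ite, h4, mul_zero]
      linarith
  have base : ∃ k ∈ Set.Icc 0 h, ∃ ε : ℝ, 0 < ε ∧
      ∀ v, outSum k v - inSum k v = (if v = a then ε else 0) - if v = y then ε else 0 := by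
    clear hb b
    induction hr with
    | refl => exact ⟨0, ⟨le_rfl, h0⟩, 1, one_pos, fun v => by simp [outSum, inSum]⟩
    | tail _ hyz ih =>
      obtain ⟨k, hk, ε, hε, -, hnet⟩ := extend _ _ hyz ih
      exact ⟨k, hk, ε, hε, hnet⟩
  obtain ⟨k, hk, ε, -, hpos, hnet⟩ := extend _ _ hb base
  exact ⟨k, hk, ε, hpos, hnet⟩

theorem outSum_nonneg {h : V × V → ℝ} (h0 : 0 ≤ h) (x : V) : 0 ≤ outSum h x :=
  tsum_nonneg fun _ => h0 _

theorem inSum_nonneg {h : V × V → ℝ} (h0 : 0 ≤ h) (x : V) : 0 ≤ inSum h x :=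
  tsum_nonneg fun _ => h0 _

/-- Among the functions below `q` with the same net outflow on `F`, there is one without
nonzero subcirculations on `F`. -/
theorem exists_no_subcirculation {q : V × V → ℝ} (h0 : 0 ≤ q) (hq : LocSummable q)
    (F : Finset V) :
    ∃ h ∈ Set.Icc 0 q, (∀ x ∈ F, outSum h x - inSum h x = outSum q x - inSum q x) ∧
      ∀ k ∈ Set.Icc 0 h, (∀ x ∈ F, outSum k x - inSum k x = 0) →
        ∀ x ∈ F, ∀ y, k (x, y) = 0 ∧ k (y, x) = 0 := by
  set K : Set (V × V → ℝ) :=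
    {h | h ∈ Set.Icc 0 q ∧ ∀ x ∈ F, outSum h x - inSum h x = outSum q x - inSum q x} with hK
  have hclosed : IsClosed K := by
    have : K = Set.Icc 0 q ∩ ⋂ x ∈ F, (Set.Icc 0 q ∩
        (fun h => outSum h x - inSum h x) ⁻¹' {outSum q x - inSum q x}) := by
      ext h
      simp only [hK, Set.mem_ofPred_eq, Set.mem_inter_iff, Set.mem_iInter, Set.mem_preimage,
        Set.mem_singleton_iff]
      exact ⟨fun ⟨a, b⟩ => ⟨a, fun x hx => ⟨a, b x hx⟩⟩, fun ⟨a, b⟩ => ⟨a, fun x hx => (b x hx).2⟩⟩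
    rw [this]
    refine isClosed_Icc.inter (isClosed_biInter fun x _ => ?_)
    exact ((continuousOn_outSum hq x).sub (continuousOn_inSum hq x)).preimage_isClosed_of_isClosed
      isClosed_Icc isClosed_singleton
  have hcomp : IsCompact K :=
    (isCompact_Icc (a := (0 : V × V → ℝ)) (b := q)).of_isClosed_subset hclosed fun h hh => hh.1
  obtain ⟨h, ⟨hh, hnet⟩, hmin⟩ := hcomp.exists_isMinOn ⟨q, ⟨h0, le_rfl⟩, fun _ _ => rfl⟩
    (f := fun h => ∑ x ∈ F, (outSum h x + inSum h x))
    ((continuousOn_finsetSum F fun x _ =>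
      (continuousOn_outSum hq x).add (continuousOn_inSum hq x)).mono fun h hh => hh.1)
  have hls := hq.of_le hh.1 hh.2
  refine ⟨h, hh, hnet, fun k hk hk0 x hx => ?_⟩
  have hlk := hls.of_le hk.1 hk.2
  have hmem : h - k ∈ K := by
    refine ⟨⟨fun e => sub_nonneg.2 (hk.2 e), fun e => ?_⟩, fun x hx => ?_⟩
    · have h1 : 0 ≤ k e := hk.1 e
      have h2 : h e ≤ q e := hh.2 e
      simp only [Pi.sub_apply]
      linarith
    · rw [outSum_sub hls hlk, inSum_sub hls hlk]
      linarith [hnet x hx, hk0 x hx]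
  have hle : ∑ x ∈ F, (outSum h x + inSum h x) ≤
      ∑ x ∈ F, (outSum (h - k) x + inSum (h - k) x) := hmin hmem
  have hsum : ∑ x ∈ F, (outSum k x + inSum k x) ≤ 0 := by
    have : ∑ x ∈ F, (outSum (h - k) x + inSum (h - k) x) =
        ∑ x ∈ F, (outSum h x + inSum h x) - ∑ x ∈ F, (outSum k x + inSum k x) := by
      rw [← Finset.sum_sub_distrib]
      refine Finset.sum_congr rfl fun x _ => ?_
      rw [outSum_sub hls hlk, inSum_sub hls hlk]
      ring
    linarith
  have hx0 : outSum k x + inSum k x ≤ 0 :=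
    (Finset.single_le_sum (f := fun x => outSum k x + inSum k x)
      (fun x _ => add_nonneg (outSum_nonneg hk.1 x) (inSum_nonneg hk.1 x)) hx).trans hsum
  have ho := outSum_nonneg hk.1 x
  have hi := inSum_nonneg hk.1 x
  have ho' : outSum k x ≤ 0 := by linarith
  have hi' : inSum k x ≤ 0 := by linarith
  exact fun y => ⟨le_antisymm (((hlk.out x).le_tsum y fun _ _ => hk.1 _).trans ho') (hk.1 _),
    le_antisymm (((hlk.inn x).le_tsum y fun _ _ => hk.1 _).trans hi') (hk.1 _)⟩

/-- The finite version of `exists_reduced`. -/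
theorem exists_reduced_finset {q : V × V → ℝ} (h0 : 0 ≤ q) (hq : LocSummable q)
    (F : Finset V) {s : V} (hs : s ∈ F) {δ : ℝ} (hδ : 0 ≤ δ)
    (hnet : ∀ x ∈ F, outSum q x - inSum q x = if x = s then δ else 0) :
    ∃ h ∈ Set.Icc 0 q, (∀ x ∈ F, outSum h x - inSum h x = (if x = s then δ else 0) ∧
      inSum h x ≤ if x = s then 0 else δ) ∧ ∀ x ∉ F, inSum h x ≤ δ := by
  obtain ⟨h, hh, hhnet, hno⟩ := exists_no_subcirculation h0 hq F
  have hls := hq.of_le hh.1 hh.2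
  have hpos : ∀ e, 0 ≤ h e := hh.1
  have hb : ∀ x ∈ F, outSum h x - inSum h x = if x = s then δ else 0 :=
    fun x hx => (hhnet x hx).trans (hnet x hx)
  have hb0 : ∀ x : V, 0 ≤ if x = s then δ else 0 := fun x => by split_ifs <;> simp [hδ]
  have nopath : ∀ a y b, Relation.ReflTransGen (fun u v => 0 < h (u, v)) a y → 0 < h (y, b) →
      y ∈ F → (a = b ∨ (a ∉ F ∧ b ∉ F)) → False := by
    intro a y b hr hyb hyF hab
    obtain ⟨k, hk, ε, hkpos, hknet⟩ := exists_subwalk hh.1 hls hr hyb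
    refine hkpos.ne' (hno k hk (fun x hx => ?_) y hyF b).1
    rw [hknet x]
    rcases hab with rfl | ⟨ha, hb⟩
    · simp
    · rw [if_neg (ne_of_mem_of_not_mem hx ha), if_neg (ne_of_mem_of_not_mem hx hb), sub_zero]
  set D : V → Finset V := fun x =>
    F.filter fun z => Relation.ReflTransGen (fun u v => 0 < h (u, v)) x z with hD
  have hDmem : ∀ x z, z ∈ D x ↔ z ∈ F ∧ Relation.ReflTransGen (fun u v => 0 < h (u, v)) x z :=
    fun x z => by simp [hD]
  have hDstep : ∀ x y z, y ∈ D x → z ∉ D x → z ∈ F → h (y, z) = 0 := by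
    intro x y z hy hz hzF
    by_contra hne
    exact hz ((hDmem _ _).2 ⟨hzF, ((hDmem _ _).1 hy).2.tail ((hpos _).lt_of_ne' hne)⟩)
  have hself : ∀ x ∈ F, x ∈ D x := fun x hx => (hDmem _ _).2 ⟨hx, .refl⟩
  have hcut : ∀ S ⊆ F, setOutflow h S - setInflow h S = ∑ x ∈ S, if x = s then δ else 0 := by
    intro S hS
    rw [← setOutflow_sub_setInflow hls]
    exact Finset.sum_congr rfl fun x hx => hb x (hS hx)
  have hDsub : ∀ x, D x ⊆ F := fun x => Finset.filter_subset _ _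
  have hin : ∀ x ∈ F, ∀ S : Finset V, x ∈ S →
      ∑' z, (if z ∈ S then 0 else h (z, x)) ≤ setInflow h S := by
    intro x hx S hxS
    exact Finset.single_le_sum (f := fun x => ∑' z, (if z ∈ S then 0 else h (z, x)))
      (fun y _ => tsum_nonneg fun z => by split_ifs <;> simp [hpos]) hxS
  have hback : ∀ x ∈ F, inSum h x ≤ setInflow h (D x) := by
    intro x hx
    refine le_trans (le_of_eq (tsum_congr fun z => ?_)) (hin x hx (D x) (hself x hx))
    split_ifs with hz
    · by_contra hne
      exact nopath x z x ((hDmem _ _).1 hz).2 ((hpos _).lt_of_ne' hne) ((hDmem _ _).1 hz).1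
        (Or.inl rfl)
    · rfl
  have hout0 : ∀ z ∉ F, ∀ y ∈ F, h (z, y) = 0 := by
    intro z hz y hy
    by_contra hne
    have hzy := (hpos _).lt_of_ne' hne
    have h1 : setOutflow h (D y) = 0 := by
      refine Finset.sum_eq_zero fun u hu => ?_
      refine (tsum_congr fun v => ?_).trans tsum_zero
      split_ifs with hv
      · rfl
      · by_cases hvF : v ∈ F
        · exact hDstep y u v hu hv hvF
        · by_contra hne'
          exact nopath z u v (.head hzy ((hDmem _ _).1 hu).2) ((hpos _).lt_of_ne' hne')
            (hDsub _ hu) (Or.inr ⟨hz, hvF⟩)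
    have h2 := hcut (D y) (hDsub y)
    have h3 : 0 ≤ ∑ x ∈ D y, if x = s then δ else 0 := Finset.sum_nonneg fun x _ => hb0 x
    have h4 := hback y hy
    have h5 : h (z, y) ≤ inSum h y := (hls.inn y).le_tsum z fun _ _ => hpos _
    linarith
  have hF : setOutflow h F = δ := by
    have h1 : setInflow h F = 0 := by
      refine Finset.sum_eq_zero fun u hu => ?_
      refine (tsum_congr fun v => ?_).trans tsum_zero
      split_ifs with hv
      · rfl
      · exact hout0 v hv u hu
    have h2 := hcut F subset_rfl
    rw [h1, sub_zero, Finset.sum_ite_eq' F s, if_pos hs] at h2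
    exact h2
  have hterm : ∀ (S : Finset V) (y : V), 0 ≤ ∑' z, if z ∈ S then 0 else h (y, z) :=
    fun S y => tsum_nonneg fun z => by split_ifs <;> simp [hpos]
  have hDout : ∀ x, setOutflow h (D x) ≤ δ := by
    intro x
    rw [← hF]
    refine le_trans (Finset.sum_le_sum fun y hy => ?_)
      (Finset.sum_le_sum_of_subset_of_nonneg (hDsub x) fun y _ _ => hterm F y)
    refine (summable_ite_mem (hls.out y) _).tsum_le_tsum (fun z => ?_)
      (summable_ite_mem (hls.out y) _)
    by_cases hz : z ∈ D x
    · simp only [hz, if_true]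
      split_ifs <;> simp [hpos]
    · by_cases hzF : z ∈ F
      · simp [hz, hzF, hDstep x y z hy hz hzF]
      · simp [hz, hzF]
  have hinbound : ∀ x ∈ F, inSum h x ≤ if x = s then 0 else δ := by
    intro x hx
    have h1 := hback x hx
    have h2 := hcut (D x) (hDsub x)
    have h3 := hDout x
    have h4 : (if x = s then δ else 0) ≤ ∑ x ∈ D x, if x = s then δ else 0 :=
      Finset.single_le_sum (f := fun x => if x = s then δ else 0) (fun x _ => hb0 x) (hself x hx)
    split_ifs at h4 ⊢ <;> linarith
  have hin' : ∀ x ∈ F, inSum (fun e => if e.1 ∈ F then h e else 0) x = inSum h x := by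
    intro x hx
    refine tsum_congr fun z => ?_
    by_cases hz : z ∈ F
    · simp [hz]
    · simp [hz, hout0 z hz x hx]
  have hout' : ∀ x ∈ F, outSum (fun e => if e.1 ∈ F then h e else 0) x = outSum h x :=
    fun x hx => tsum_congr fun z => by simp [hx]
  refine ⟨fun e => if e.1 ∈ F then h e else 0, ⟨fun e => ?_, fun e => ?_⟩, fun x hx => ?_,
    fun x hx => ?_⟩
  · show (0 : ℝ) ≤ if e.1 ∈ F then h e else 0
    split_ifs <;> simp [hpos]
  · show (if e.1 ∈ F then h e else 0) ≤ q e
    split_ifs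
    · exact hh.2 e
    · exact h0 e
  · rw [hin' x hx, hout' x hx]
    exact ⟨hb x hx, hinbound x hx⟩
  · have h1 : inSum (fun e => if e.1 ∈ F then h e else 0) x = ∑ y ∈ F, h (y, x) := by
      unfold inSum
      rw [tsum_eq_sum (s := F) fun y hy => if_neg hy]
      exact Finset.sum_congr rfl fun y hy => if_pos hy
    rw [h1, ← hF]
    refine Finset.sum_le_sum fun y _ => ?_
    have := (summable_ite_mem (hls.out y) F).le_tsum x fun z _ => by split_ifs <;> simp [hpos]
    simpa [hx] using this

/-- A flow with arbitrary sources at infinity and at `t` contains one of the same net value at `s`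
that carries at most this value through every vertex. -/
theorem exists_reduced {q : V × V → ℝ} (h0 : 0 ≤ q) (hq : LocSummable q)
    {s t : V} (hst : s ≠ t) {δ : ℝ} (hδ : 0 ≤ δ)
    (hnet : ∀ x, x ≠ t → outSum q x - inSum q x = if x = s then δ else 0) :
    ∃ h ∈ Set.Icc 0 q, (∀ x, x ≠ t → outSum h x - inSum h x = if x = s then δ else 0) ∧
      ∀ x, inSum h x ≤ if x = s then 0 else δ := by
  set C : V → Set (V × V → ℝ) := fun x =>
    (Set.Icc 0 q ∩ (fun h => outSum h x - inSum h x) ⁻¹'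
      {r | x ≠ t → r = if x = s then δ else 0}) ∩
    (Set.Icc 0 q ∩ (fun h => inSum h x) ⁻¹' Set.Iic (if x = s then 0 else δ)) with hC
  have hclosed : ∀ x, IsClosed (C x) := by
    intro x
    refine IsClosed.inter ?_ ((continuousOn_inSum hq x).preimage_isClosed_of_isClosed
      isClosed_Icc isClosed_Iic)
    refine ((continuousOn_outSum hq x).sub (continuousOn_inSum hq x)).preimage_isClosed_of_isClosed
      isClosed_Icc ?_
    by_cases hx : x = t
    · simp [hx]
    · simp only [ne_eq, hx, not_false_eq_true, forall_const]
      exact isClosed_singleton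
  obtain ⟨h, hh, hmem⟩ := (isCompact_Icc (a := (0 : V × V → ℝ)) (b := q)).inter_iInter_nonempty
    C hclosed fun u => by
      obtain ⟨h, hh, hF, hF'⟩ := exists_reduced_finset h0 hq (insert s (u.erase t))
        (Finset.mem_insert_self _ _) hδ fun x hx => hnet x (by
          rintro rfl
          rcases Finset.mem_insert.1 hx with h | h
          · exact hst h.symm
          · exact Finset.notMem_erase _ _ h)
      refine ⟨h, hh, Set.mem_iInter₂.2 fun x hx => ?_⟩
      by_cases hxt : x = t
      · subst hxt
        refine ⟨⟨hh, fun hne => absurd rfl hne⟩, hh, ?_⟩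
        have := hF' x (by simp [hst.symm])
        simpa [hst.symm] using this
      · have := hF x (by simp [hxt, hx])
        exact ⟨⟨hh, fun _ => this.1⟩, hh, this.2⟩
  rw [Set.mem_iInter] at hmem
  exact ⟨h, hh, fun x => (hmem x).1.2, fun x => (hmem x).2.2⟩

/-- A real-valued flow with finite in- and out-sums. -/
structure IsRealFlow (N : Network V) (f : V × V → ℝ) : Prop where
  nonneg : 0 ≤ f
  cap : ∀ e, f e ≤ N.c e
  supp : ∀ e, e ∉ N.E → f e = 0
  loc : LocSummable f
  kirchhoff : ∀ x, x ≠ N.s → x ≠ N.t → outSum f x = inSum f x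

theorem isRealFlow_zero (N : Network V) : IsRealFlow N 0 where
  nonneg := le_rfl
  cap e := (N.c e).2
  supp _ _ := rfl
  loc := ⟨fun _ => summable_zero, fun _ => summable_zero⟩
  kirchhoff _ _ _ := rfl

theorem IsRealFlow.inSum_source {N : Network V} {f : V × V → ℝ} (hf : IsRealFlow N f) :
    inSum f N.s = 0 := by
  unfold inSum
  simp [fun y => hf.supp (y, N.s) (N.no_in_s y)]

theorem IsRealFlow.net {N : Network V} {f : V × V → ℝ} (hf : IsRealFlow N f) (x : V)
    (hx : x ≠ N.t) : outSum f x - inSum f x = if x = N.s then outSum f N.s else 0 := by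
  split_ifs with hs
  · rw [hs, hf.inSum_source, sub_zero]
  · rw [hf.kirchhoff x hs hx, sub_self]

theorem IsRealFlow.exists_reduced {N : Network V} {f : V × V → ℝ} (hf : IsRealFlow N f) :
    ∃ h, IsRealFlow N h ∧ outSum h N.s = outSum f N.s ∧ ∀ x, inSum h x ≤ outSum f N.s := by
  have hv := outSum_nonneg hf.nonneg N.s
  obtain ⟨h, hh, hnet, hin⟩ := _root_.exists_reduced hf.nonneg hf.loc N.ne hv hf.net
  have hflow : IsRealFlow N h :=
    { nonneg := hh.1
      cap := fun e => (hh.2 e).trans (hf.cap e)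
      supp := fun e he => le_antisymm ((hh.2 e).trans_eq (hf.supp e he)) (hh.1 e)
      loc := hf.loc.of_le hh.1 hh.2
      kirchhoff := fun x hs ht => by
        have := hnet x ht
        rw [if_neg hs] at this
        linarith }
  refine ⟨h, hflow, ?_, fun x => (hin x).trans ?_⟩
  · have := hnet N.s N.ne
    rw [if_pos rfl, hflow.inSum_source, sub_zero] at this
    exact this
  · split_ifs
    · exact hv
    · exact le_rfl

/-- A flow can be augmented to any larger attainable value by a change that is small at every
vertex. -/
theorem IsRealFlow.exists_augment {N : Network V} {f g : V × V → ℝ} (hf : IsRealFlow N f)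
    (hg : IsRealFlow N g) (hfg : outSum f N.s ≤ outSum g N.s) :
    ∃ f', IsRealFlow N f' ∧ outSum f' N.s = outSum g N.s ∧
      ∀ x, x ≠ N.t → outSum (fun e => |f' e - f e|) x ≤ 2 * (outSum g N.s - outSum f N.s) := by
  set p : V × V → ℝ := fun e => max (g e - f e) 0 with hp
  set m : V × V → ℝ := fun e => max (f e - g e) 0 with hm
  have hp0 : ∀ e, 0 ≤ p e := fun e => le_max_right _ _
  have hm0 : ∀ e, 0 ≤ m e := fun e => le_max_right _ _
  have hpm : ∀ e, p e - m e = g e - f e := by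
    intro e
    simp only [hp, hm]
    rcases le_total (g e) (f e) with h | h
    · rw [max_eq_right (by linarith), max_eq_left (by linarith)]; ring
    · rw [max_eq_left (by linarith), max_eq_right (by linarith)]; ring
  have hlp : LocSummable p := hg.loc.of_le hp0 fun e =>
    max_le (by linarith [show 0 ≤ f e from hf.nonneg e]) (hg.nonneg e)
  have hlm : LocSummable m := hf.loc.of_le hm0 fun e =>
    max_le (by linarith [show 0 ≤ g e from hg.nonneg e]) (hf.nonneg e)
  have hlms : LocSummable (fun e => m e.swap) := ⟨fun x => hlm.inn x, fun x => hlm.out x⟩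
  set q : V × V → ℝ := p + fun e => m e.swap with hqdef
  have hq0 : 0 ≤ q := fun e => add_nonneg (hp0 e) (hm0 _)
  have hlq : LocSummable q := hlp.add hlms
  have hδ : 0 ≤ outSum g N.s - outSum f N.s := by linarith
  have hpm' : p - m = g - f := funext hpm
  have hqnet : ∀ x, outSum q x - inSum q x =
      (outSum g x - inSum g x) - (outSum f x - inSum f x) := by
    intro x
    rw [hqdef, outSum_add hlp hlms, inSum_add hlp hlms]
    have h1 : outSum (fun e => m e.swap) x = inSum m x := rfl
    have h2 : inSum (fun e => m e.swap) x = outSum m x := rfl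
    have h3 := congrArg (fun k => outSum k x) hpm'
    have h4 := congrArg (fun k => inSum k x) hpm'
    simp only [outSum_sub hlp hlm, inSum_sub hlp hlm, outSum_sub hg.loc hf.loc,
      inSum_sub hg.loc hf.loc] at h3 h4
    rw [h1, h2]
    linarith
  obtain ⟨h, hh, hnet, hin⟩ := _root_.exists_reduced hq0 hlq N.ne hδ fun x hx => by
    rw [hqnet, hg.net x hx, hf.net x hx]
    split_ifs <;> ring
  have hlh := hlq.of_le hh.1 hh.2
  have hhpos : ∀ e, 0 ≤ h e := hh.1
  set r : V × V → ℝ := fun e => h e / q e with hr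
  have hr0 : ∀ e, 0 ≤ r e := fun e => div_nonneg (hh.1 e) (hq0 e)
  have hr1 : ∀ e, r e ≤ 1 := fun e => div_le_one_of_le₀ (hh.2 e) (hq0 e)
  have hrq : ∀ e, r e * p e + r e * m e.swap = h e := by
    intro e
    have h1 : r e * q e = h e := by
      rcases eq_or_ne (q e) 0 with h0 | h0
      · have : h e = 0 := le_antisymm (h0 ▸ hh.2 e) (hh.1 e)
        rw [h0, this, mul_zero]
      · exact div_mul_cancel₀ _ h0
    rw [← h1, ← mul_add]
    rfl
  set a : V × V → ℝ := fun e => r e * p e with ha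
  set b : V × V → ℝ := fun e => r e.swap * m e with hb
  have ha0 : ∀ e, 0 ≤ a e := fun e => mul_nonneg (hr0 e) (hp0 e)
  have hb0 : ∀ e, 0 ≤ b e := fun e => mul_nonneg (hr0 _) (hm0 e)
  have hap : ∀ e, a e ≤ p e := fun e => mul_le_of_le_one_left (hp0 e) (hr1 e)
  have hbm : ∀ e, b e ≤ m e := fun e => mul_le_of_le_one_left (hm0 e) (hr1 _)
  have hab : ∀ e, a e + b e.swap = h e := fun e => by
    simp only [ha, hb, Prod.swap_swap]
    exact hrq e
  have hla := hlp.of_le ha0 hap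
  have hlb := hlm.of_le hb0 hbm
  have hlbs : LocSummable (fun e => b e.swap) := ⟨fun x => hlb.inn x, fun x => hlb.out x⟩
  have hlf' : LocSummable (f + a - b) := (hf.loc.add hla).sub hlb
  have hhsum : (a + fun e => b e.swap) = h := funext hab
  have hout : ∀ x, outSum h x = outSum a x + inSum b x := fun x => by
    rw [← hhsum, outSum_add hla hlbs]; rfl
  have hinn : ∀ x, inSum h x = inSum a x + outSum b x := fun x => by
    rw [← hhsum, inSum_add hla hlbs]; rfl
  have hnetf' : ∀ x, outSum (f + a - b) x - inSum (f + a - b) x =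
      (outSum f x - inSum f x) + (outSum h x - inSum h x) := fun x => by
    rw [outSum_sub (hf.loc.add hla) hlb, inSum_sub (hf.loc.add hla) hlb,
      outSum_add hf.loc hla, inSum_add hf.loc hla, hout, hinn]
    ring
  have hbetween : ∀ e, (f + a - b) e ∈ Set.Icc (min (f e) (g e)) (max (f e) (g e)) := by
    intro e
    have h1 := hap e
    have h2 := hbm e
    have h3 := ha0 e
    have h4 := hb0 e
    simp only [hp, hm] at h1 h2
    simp only [Pi.sub_apply, Pi.add_apply]
    rcases le_total (g e) (f e) with h | h
    · rw [max_eq_right (by linarith)] at h1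
      rw [max_eq_left (by linarith)] at h2
      rw [min_eq_right h, max_eq_left h]
      constructor <;> linarith
    · rw [max_eq_left (by linarith)] at h1
      rw [max_eq_right (by linarith)] at h2
      rw [min_eq_left h, max_eq_right h]
      constructor <;> linarith
  have hflow : IsRealFlow N (f + a - b) :=
    { nonneg := fun e => (le_min (hf.nonneg e) (hg.nonneg e)).trans (hbetween e).1
      cap := fun e => (hbetween e).2.trans (max_le (hf.cap e) (hg.cap e))
      supp := fun e he => by
        have := hbetween e
        rw [hf.supp e he, hg.supp e he, min_self, max_self, Set.Icc_self] at this
        exact this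
      loc := hlf'
      kirchhoff := fun x hs ht => by
        have h1 := hnetf' x
        rw [hnet x ht, hf.kirchhoff x hs ht, if_neg hs] at h1
        linarith }
  refine ⟨f + a - b, hflow, ?_, fun x hx => ?_⟩
  · have h1 := hnetf' N.s
    rw [hnet N.s N.ne, hflow.inSum_source, hf.inSum_source, if_pos rfl] at h1
    linarith
  · have h1 : outSum (fun e => |(f + a - b) e - f e|) x ≤ outSum (a + b) x := by
      have hle : ∀ y, |(f + a - b) (x, y) - f (x, y)| ≤ (a + b) (x, y) := fun y => by
        have h3 := ha0 (x, y)
        have h4 := hb0 (x, y)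
        simp only [Pi.sub_apply, Pi.add_apply]
        rw [abs_le]
        constructor <;> linarith
      exact (((hla.add hlb).out x).of_nonneg_of_le (fun _ => abs_nonneg _) hle).tsum_le_tsum hle
        ((hla.add hlb).out x)
    rw [outSum_add hla hlb] at h1
    have h2 := hout x
    have h3 := hinn x
    have h4 := inSum_nonneg ha0 x
    have h5 := inSum_nonneg hb0 x
    have h6 := hnet x hx
    have h7 := hin x
    split_ifs at h6 h7 <;> linarith

/-- A sequence of flows with increasing bounded values and accordingly small changes at every
vertex converges to a flow of the limit value. -/
theorem exists_limit_flow {N : Network V} (hc : ∀ x, Summable fun v => (N.c (v, x) : ℝ))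
    {F : ℕ → V × V → ℝ} (hF : ∀ n, IsRealFlow N (F n)) {M : ℝ}
    (hM : ∀ n, outSum (F n) N.s ≤ M)
    (hstep : ∀ n x, x ≠ N.t → outSum (fun e => |F (n + 1) e - F n e|) x ≤
      2 * (outSum (F (n + 1)) N.s - outSum (F n) N.s)) :
    ∃ f, IsRealFlow N f ∧
      Filter.Tendsto (fun n => outSum (F n) N.s) Filter.atTop (nhds (outSum f N.s)) := by
  set d : ℕ → V × V → ℝ := fun n e => |F (n + 1) e - F n e| with hd
  have hd0 : ∀ n e, 0 ≤ d n e := fun n e => abs_nonneg _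
  have hld : ∀ n, LocSummable (d n) := fun n =>
    ((hF (n + 1)).loc.add (hF n).loc).of_le (hd0 n) fun e => by
      have h1 : 0 ≤ F (n + 1) e := (hF (n + 1)).nonneg e
      have h2 : 0 ≤ F n e := (hF n).nonneg e
      simp only [hd, Pi.add_apply]
      rw [abs_le]
      constructor <;> linarith
  have hfin : ∀ x, x ≠ N.t → ∀ (u : Finset V) (n : ℕ),
      ∑ i ∈ Finset.range n, ∑ y ∈ u, d i (x, y) ≤ 2 * M := by
    intro x hx u n
    have h1 : ∑ i ∈ Finset.range n, ∑ y ∈ u, d i (x, y) ≤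
        ∑ i ∈ Finset.range n, 2 * (outSum (F (i + 1)) N.s - outSum (F i) N.s) :=
      Finset.sum_le_sum fun i _ =>
        (((hld i).out x).sum_le_tsum u fun _ _ => hd0 _ _).trans (hstep i x hx)
    rw [← Finset.mul_sum, Finset.sum_range_sub (fun n => outSum (F n) N.s)] at h1
    have h2 := outSum_nonneg (hF 0).nonneg N.s
    have h3 := hM n
    linarith
  have hd_t : ∀ n y, d n (N.t, y) = 0 := fun n y => by
    simp [hd, (hF n).supp _ (N.no_out_t y), (hF (n + 1)).supp _ (N.no_out_t y)]
  have hsumn : ∀ e, Summable fun n => d n e := by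
    rintro ⟨x, y⟩
    by_cases hx : x = N.t
    · subst hx
      simp only [hd_t]
      exact summable_zero
    · refine summable_of_sum_range_le (c := 2 * M) (fun n => hd0 n _) fun n => ?_
      simpa using hfin x hx {y} n
  have hsumB : ∀ x, Summable fun y => ∑' n, d n (x, y) := by
    intro x
    by_cases hx : x = N.t
    · subst hx
      simp only [hd_t, tsum_zero]
      exact summable_zero
    · refine summable_of_sum_le (c := 2 * M) (fun y => tsum_nonneg fun n => hd0 n _) fun u => ?_
      rw [← Summable.tsum_finsetSum fun y _ => hsumn (x, y)]
      exact Real.tsum_le_of_sum_range_le (fun n => Finset.sum_nonneg fun y _ => hd0 n _)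
        fun n => hfin x hx u n
  have hconv : ∀ e, ∃ a, Filter.Tendsto (fun n => F n e) Filter.atTop (nhds a) := fun e =>
    cauchySeq_tendsto_of_complete (cauchySeq_of_summable_dist (by
      refine (hsumn e).congr fun n => ?_
      rw [Real.dist_eq, abs_sub_comm]))
  choose f hf using hconv
  have hBbound : ∀ n e, F n e ≤ F 0 e + ∑' i, d i e := by
    intro n e
    have h1 : F n e - F 0 e ≤ ∑ i ∈ Finset.range n, d i e := by
      rw [← Finset.sum_range_sub (fun n => F n e)]
      exact Finset.sum_le_sum fun i _ => le_abs_self _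
    have h2 := (hsumn e).sum_le_tsum (Finset.range n) fun i _ => hd0 i e
    linarith
  have hB : ∀ x, Summable fun y => F 0 (x, y) + ∑' i, d i (x, y) :=
    fun x => ((hF 0).loc.out x).add (hsumB x)
  have hf0 : 0 ≤ f := fun e => ge_of_tendsto' (hf e) fun n => (hF n).nonneg e
  have hfc : ∀ e, f e ≤ N.c e := fun e => le_of_tendsto' (hf e) fun n => (hF n).cap e
  have hfB : ∀ e, f e ≤ F 0 e + ∑' i, d i e := fun e => le_of_tendsto' (hf e) fun n => hBbound n e
  have hout : ∀ x, Filter.Tendsto (fun n => outSum (F n) x) Filter.atTop (nhds (outSum f x)) :=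
    fun x => tendsto_tsum_of_dominated_convergence (hB x) (fun y => hf _)
      (Filter.Eventually.of_forall fun n y => by
        rw [Real.norm_of_nonneg ((hF n).nonneg _)]
        exact hBbound n _)
  have hinn : ∀ x, Filter.Tendsto (fun n => inSum (F n) x) Filter.atTop (nhds (inSum f x)) :=
    fun x => tendsto_tsum_of_dominated_convergence (hc x) (fun y => hf _)
      (Filter.Eventually.of_forall fun n y => by
        rw [Real.norm_of_nonneg ((hF n).nonneg _)]
        exact (hF n).cap _)
  refine ⟨f, ?_, hout N.s⟩
  exact
    { nonneg := hf0
      cap := hfc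
      supp := fun e he => tendsto_nhds_unique (hf e)
        (by simp only [(hF _).supp e he]; exact tendsto_const_nhds)
      loc := ⟨fun x => (hB x).of_nonneg_of_le (fun _ => hf0 _) (fun _ => hfB _),
        fun x => (hc x).of_nonneg_of_le (fun _ => hf0 _) (fun _ => hfc _)⟩
      kirchhoff := fun x hs ht => tendsto_nhds_unique (hout x)
        (by simp only [(hF _).kirchhoff x hs ht]; exact hinn x) }

/-- If the values of flows have a finite least upper bound, it is attained. -/
theorem exists_max_realFlow {N : Network V} (hc : ∀ x, Summable fun v => (N.c (v, x) : ℝ))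
    {M : ℝ} (hM : ∀ f, IsRealFlow N f → outSum f N.s ≤ M)
    (hlub : ∀ r < M, ∃ f, IsRealFlow N f ∧ r < outSum f N.s) :
    ∃ f, IsRealFlow N f ∧ outSum f N.s = M := by
  have step : ∀ f : {f // IsRealFlow N f}, ∃ f' : {f // IsRealFlow N f},
      M - outSum f'.1 N.s ≤ (M - outSum f.1 N.s) / 2 ∧
      ∀ x, x ≠ N.t → outSum (fun e => |f'.1 e - f.1 e|) x ≤
        2 * (outSum f'.1 N.s - outSum f.1 N.s) := by
    rintro ⟨f, hf⟩
    rcases (hM f hf).eq_or_lt with h | h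
    · exact ⟨⟨f, hf⟩, by simp [h], fun x _ => by simp [outSum]⟩
    · obtain ⟨g, hg, hgv⟩ := hlub ((M + outSum f N.s) / 2) (by linarith)
      obtain ⟨f', hf', hv, hx⟩ := hf.exists_augment hg (by linarith)
      refine ⟨⟨f', hf'⟩, ?_, fun x hxt => ?_⟩
      · simp only [hv]
        linarith
      · simp only [hv]
        exact hx x hxt
  choose next hnext hchange using step
  set F : ℕ → {f // IsRealFlow N f} := fun n => next^[n] ⟨0, isRealFlow_zero N⟩ with hFdef
  have hsucc : ∀ n, F (n + 1) = next (F n) := fun n => Function.iterate_succ_apply' _ _ _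
  obtain ⟨f, hf, hlim⟩ := exists_limit_flow hc (fun n => (F n).2) (fun n => hM _ (F n).2)
    fun n x hx => by
      rw [hsucc]
      exact hchange (F n) x hx
  refine ⟨f, hf, tendsto_nhds_unique hlim ?_⟩
  have hgap : ∀ n, M - outSum (F n).1 N.s ≤ (M - outSum (F 0).1 N.s) * (1 / 2) ^ n := by
    intro n
    induction n with
    | zero => simp
    | succ n ih =>
      have := hnext (F n)
      rw [← hsucc] at this
      rw [pow_succ]
      linarith
  have hpow : Filter.Tendsto (fun n : ℕ => M - (M - outSum (F 0).1 N.s) * (1 / 2) ^ n)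
      Filter.atTop (nhds M) := by
    have := ((tendsto_pow_atTop_nhds_zero_of_lt_one (r := (1 / 2 : ℝ)) (by norm_num)
      (by norm_num)).const_mul (M - outSum (F 0).1 N.s)).const_sub M
    simpa using this
  exact tendsto_of_tendsto_of_tendsto_of_le_of_le hpow tendsto_const_nhds
    (fun n => by linarith [hgap n]) (fun n => hM _ (F n).2)

theorem tsum_ne_top_of_le {ι : Type*} {f g : ι → ℝ≥0} (h : ∀ i, f i ≤ g i)
    (hg : ∑' i, (g i : ℝ≥0∞) ≠ ⊤) : ∑' i, (f i : ℝ≥0∞) ≠ ⊤ :=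
  ne_top_of_le_ne_top hg (ENNReal.tsum_le_tsum fun i => ENNReal.coe_le_coe.2 (h i))

theorem summable_coe_real_of_tsum_ne_top {ι : Type*} {f : ι → ℝ≥0}
    (hf : ∑' i, (f i : ℝ≥0∞) ≠ ⊤) : Summable fun i => (f i : ℝ) :=
  NNReal.summable_coe.2 (ENNReal.tsum_coe_ne_top_iff_summable.1 hf)

theorem dplus_toReal (f : V × V → ℝ≥0) (x : V) :
    (dplus f x).toReal = outSum (fun e => (f e : ℝ)) x :=
  ENNReal.tsum_toReal_eq fun _ => ENNReal.coe_ne_top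

theorem dminus_toReal (f : V × V → ℝ≥0) (x : V) :
    (dminus f x).toReal = inSum (fun e => (f e : ℝ)) x :=
  ENNReal.tsum_toReal_eq fun _ => ENNReal.coe_ne_top

theorem IsFlow.isRealFlow {N : Network V} (hc : ∀ x, (∑' v, (N.c (v, x) : ℝ≥0∞)) ≠ ⊤)
    {f : V × V → ℝ≥0} (hf : IsFlow N f) (hv : flowValue N f ≠ ⊤) :
    IsRealFlow N fun e => (f e : ℝ) := by
  have hin : ∀ x, dminus f x ≠ ⊤ := fun x => tsum_ne_top_of_le (fun v => hf.cap _) (hc x)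
  have hout : ∀ x, dplus f x ≠ ⊤ := by
    intro x
    by_cases hs : x = N.s
    · rw [hs]
      exact hv
    by_cases ht : x = N.t
    · simp [dplus, ht, hf.supp _ (N.no_out_t _)]
    · rw [hf.kirchhoff x hs ht]
      exact hin x
  exact
    { nonneg := fun e => (f e).2
      cap := fun e => NNReal.coe_le_coe.2 (hf.cap e)
      supp := fun e he => by simp [hf.supp e he]
      loc := ⟨fun x => summable_coe_real_of_tsum_ne_top (hout x),
        fun x => summable_coe_real_of_tsum_ne_top (hin x)⟩
      kirchhoff := fun x hs ht => by
        rw [← dplus_toReal, ← dminus_toReal, hf.kirchhoff x hs ht] }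

theorem IsRealFlow.dplus_toNNReal {N : Network V} {f : V × V → ℝ} (hf : IsRealFlow N f) (x : V) :
    dplus (fun e => (f e).toNNReal) x = ENNReal.ofReal (outSum f x) :=
  (ENNReal.ofReal_tsum_of_nonneg (fun _ => hf.nonneg _) (hf.loc.out x)).symm

theorem IsRealFlow.dminus_toNNReal {N : Network V} {f : V × V → ℝ} (hf : IsRealFlow N f)
    (x : V) : dminus (fun e => (f e).toNNReal) x = ENNReal.ofReal (inSum f x) :=
  (ENNReal.ofReal_tsum_of_nonneg (fun _ => hf.nonneg _) (hf.loc.inn x)).symm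

theorem IsRealFlow.isFlow {N : Network V} {f : V × V → ℝ} (hf : IsRealFlow N f) :
    IsFlow N fun e => (f e).toNNReal where
  supp e he := by simp [hf.supp e he]
  cap e := Real.toNNReal_le_iff_le_coe.2 (hf.cap e)
  kirchhoff x hs ht := by rw [hf.dplus_toNNReal, hf.dminus_toNNReal, hf.kirchhoff x hs ht]

theorem exists_flow_value_top (N : Network V)
    (h : (⨆ (g : V × V → ℝ≥0) (_ : IsFlow N g), flowValue N g) = ⊤) :
    ∃ f, IsFlow N f ∧ flowValue N f = ⊤ := by
  have hbig : ∀ n : ℕ, ∃ g, IsFlow N g ∧ (2 : ℝ≥0∞) ^ (n + 1) < flowValue N g := by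
    intro n
    have : (2 : ℝ≥0∞) ^ (n + 1) < ⨆ (g : V × V → ℝ≥0) (_ : IsFlow N g), flowValue N g := by
      rw [h]
      exact ENNReal.pow_lt_top (by simp)
    simpa only [lt_iSup_iff, exists_prop] using this
  choose g hg hgv using hbig
  set w : ℕ → ℝ≥0 := fun n => 1 / 2 / 2 ^ n with hw
  have hwsum : HasSum w 1 := by
    rw [← NNReal.hasSum_coe]
    simpa [hw] using hasSum_geometric_two' 1
  have hle : ∀ e n, w n * g n e ≤ w n * N.c e := fun e n => mul_le_mul_right ((hg n).cap e) _
  have hsc : ∀ e, HasSum (fun n => w n * N.c e) (N.c e) := fun e => by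
    simpa using hwsum.mul_right (N.c e)
  have hs : ∀ e, Summable fun n => w n * g n e := fun e =>
    NNReal.summable_of_le (hle e) (hsc e).summable
  have hout : ∀ x, dplus (fun e => ∑' n, w n * g n e) x = ∑' n, (w n : ℝ≥0∞) * dplus (g n) x := by
    intro x
    simp only [dplus, ENNReal.coe_tsum (hs _), ENNReal.coe_mul]
    rw [ENNReal.tsum_comm]
    simp only [ENNReal.tsum_mul_left]
  have hinn : ∀ x, dminus (fun e => ∑' n, w n * g n e) x =
      ∑' n, (w n : ℝ≥0∞) * dminus (g n) x := by
    intro x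
    simp only [dminus, ENNReal.coe_tsum (hs _), ENNReal.coe_mul]
    rw [ENNReal.tsum_comm]
    simp only [ENNReal.tsum_mul_left]
  refine ⟨fun e => ∑' n, w n * g n e, ⟨fun e he => ?_, fun e => ?_, fun x hxs hxt => ?_⟩, ?_⟩
  · simp [(hg _).supp e he]
  · exact ((hs e).tsum_le_tsum (hle e) (hsc e).summable).trans_eq (hsc e).tsum_eq
  · rw [hout, hinn]
    exact tsum_congr fun n => by rw [(hg n).kirchhoff x hxs hxt]
  · rw [flowValue, hout, eq_top_iff, ← ENNReal.tsum_const_eq_top_of_ne_zero (α := ℕ) one_ne_zero]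
    refine ENNReal.tsum_le_tsum fun n => ?_
    have h1 : (w n : ℝ≥0∞) * 2 ^ (n + 1) = 1 := by
      have : w n * 2 ^ (n + 1) = 1 := by
        simp only [hw, pow_succ]
        field_simp
      exact_mod_cast congrArg (fun r : ℝ≥0 => (r : ℝ≥0∞)) this
    rw [← h1]
    exact mul_le_mul_right (hgv n).le _

theorem stmt9 [Countable V] (N : Network V)
    (hc : ∀ x, (∑' v, (N.c (v, x) : ℝ≥0∞)) ≠ ⊤) :
    ∃ f, IsFlow N f ∧
      flowValue N f = (⨆ (g : V × V → ℝ≥0) (_ : IsFlow N g), flowValue N g) ∧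
      ∀ x, dminus f x ≤ flowValue N f := by
  set M := ⨆ (g : V × V → ℝ≥0) (_ : IsFlow N g), flowValue N g with hM
  by_cases hMtop : M = ⊤
  · obtain ⟨f, hf, hv⟩ := exists_flow_value_top N hMtop
    exact ⟨f, hf, by rw [hv, hMtop], fun x => by rw [hv]; exact le_top⟩
  have hvM : ∀ g, IsFlow N g → flowValue N g ≤ M := fun g hg => le_iSup₂_of_le g hg le_rfl
  obtain ⟨f₀, hf₀, hv₀⟩ := exists_max_realFlow (N := N) (M := M.toReal)
    (fun x => summable_coe_real_of_tsum_ne_top (hc x))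
    (fun f hf => by
      have h1 := hvM _ hf.isFlow
      rw [flowValue, hf.dplus_toNNReal] at h1
      exact (ENNReal.ofReal_le_iff_le_toReal hMtop).1 h1)
    (fun r hr => by
      rcases lt_or_ge r 0 with h | h
      · exact ⟨0, isRealFlow_zero N, h.trans_le (outSum_nonneg le_rfl _)⟩
      have h1 : ENNReal.ofReal r < M := (ENNReal.ofReal_lt_iff_lt_toReal h hMtop).2 hr
      simp only [hM, lt_iSup_iff, exists_prop] at h1
      obtain ⟨g, hg, hgv⟩ := h1
      have hgt : flowValue N g ≠ ⊤ := ne_top_of_le_ne_top hMtop (hvM g hg)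
      refine ⟨_, hg.isRealFlow hc hgt, ?_⟩
      rw [← dplus_toReal]
      exact (ENNReal.ofReal_lt_iff_lt_toReal h hgt).1 hgv)
  obtain ⟨f, hf, hv, hin⟩ := hf₀.exists_reduced
  have hval : flowValue N (fun e => (f e).toNNReal) = M := by
    rw [flowValue, hf.dplus_toNNReal, hv, hv₀, ENNReal.ofReal_toReal hMtop]
  refine ⟨_, hf.isFlow, hval, fun x => ?_⟩
  rw [hval, hf.dminus_toNNReal, ← ENNReal.ofReal_toReal hMtop, ← hv₀]
  exact ENNReal.ofReal_le_ofReal (hin x)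
end

section
/- In every countable network there exists a flow f and an s–t cut F = E(S, V∖S) such that f saturates every edge of F and f is zero on every edge of the reverse cut E(V∖S, S). -/
open scoped ENNReal NNReal Classical

variable {V : Type}

namespace BipartiteWeb

variable {α β : Type*}

/-- The vertices with a neighbour in `X`. -/
def nbr (E : α → β → Prop) (X : Set α) : Set β := {b | ∃ a ∈ X, E a b}

/-- `g` lives on the edges leaving `X` and respects the vertex weights `u` and `v`. -/
structure Admissible (E : α → β → Prop) (X : Set α) (u : α → ℝ≥0∞) (v : β → ℝ≥0∞)
    (g : α → β → ℝ≥0∞) : Prop where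
  supp : ∀ a b, g a b ≠ 0 → a ∈ X ∧ E a b
  row_le : ∀ a, ∑' b, g a b ≤ u a
  col_le : ∀ b, ∑' a, g a b ≤ v b

/-- The total weight missing from `g` at the neighbours of `X`. -/
noncomputable def deficit (E : α → β → Prop) (X : Set α) (v : β → ℝ≥0∞)
    (g : α → β → ℝ≥0∞) : ℝ≥0∞ :=
  ∑' b, if b ∈ nbr E X then v b - ∑' a, g a b else 0

/-- The total weight missing from `g` on `X`. -/
noncomputable def excess (X : Set α) (u : α → ℝ≥0∞) (g : α → β → ℝ≥0∞) : ℝ≥0∞ :=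
  ∑' a, if a ∈ X then u a - ∑' b, g a b else 0

/-- The neighbours of some `X` can be saturated from `X` while wasting weight of `X`. -/
def Hindrance (E : α → β → Prop) (u : α → ℝ≥0∞) (v : β → ℝ≥0∞) : Prop :=
  ∃ X g, Admissible E X u v g ∧ (∀ b ∈ nbr E X, ∑' a, g a b = v b) ∧
    ∃ a ∈ X, ∑' b, g a b < u a

/-- Hall's condition for weighted, possibly infinite, bipartite graphs. -/
def HallCondition (E : α → β → Prop) (u : α → ℝ≥0∞) (v : β → ℝ≥0∞) : Prop :=
  ∀ X g, Admissible E X u v g → excess X u g ≤ deficit E X v g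

theorem HallCondition.not_hindrance {E : α → β → Prop} {u : α → ℝ≥0∞} {v : β → ℝ≥0∞}
    (h : HallCondition E u v) : ¬ Hindrance E u v := by
  rintro ⟨X, g, hg, hsat, a, ha, hlt⟩
  have h0 : deficit E X v g = 0 := by
    refine ENNReal.tsum_eq_zero.2 fun b => ?_
    split_ifs with hb
    · rw [hsat b hb, tsub_self]
    · rfl
  have h1 := (ENNReal.le_tsum a).trans ((h X g hg).trans_eq h0)
  simp only [ha, if_true, nonpos_iff_eq_zero, tsub_eq_zero_iff_le] at h1
  exact absurd hlt h1.not_gt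

/-- The matrix with a single nonzero entry, equal to `1`. -/
noncomputable def unitEntry (y : α) (z : β) (a : α) (b : β) : ℝ≥0∞ :=
  if a = y ∧ b = z then 1 else 0

theorem tsum_unitEntry_row (y : α) (z : β) (a : α) :
    ∑' b, unitEntry y z a b = if a = y then 1 else 0 := by
  by_cases h : a = y <;> simp [unitEntry, h]

theorem tsum_unitEntry_col (y : α) (z : β) (b : β) :
    ∑' a, unitEntry y z a b = if b = z then 1 else 0 := by
  by_cases h : b = z <;> simp [unitEntry, h]

/-- The columns from which a column in `C` is reached by an alternating path with `k` steps,
going backwards along `g` and forwards along `R`. -/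
def reachCol (R : α → β → Prop) (g : α → β → ℝ≥0∞) (C : Set β) : ℕ → Set β
  | 0 => C
  | k + 1 => {b | ∃ y, g y b ≠ 0 ∧ ∃ b' ∈ reachCol R g C k, R y b'}

/-- A shortest alternating path from `y` to `C` gives a direction `p - n` along which `g` can be
changed, increasing only the row sum at `y` and the column sum at some point of `C`. -/
theorem exists_augmenting_direction (R : α → β → Prop) (g : α → β → ℝ≥0∞) (C : Set β) (k : ℕ) :
    ∀ y, (∃ b ∈ reachCol R g C k, R y b) → (∀ j < k, ¬ ∃ b ∈ reachCol R g C j, R y b) →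
    ∃ (p n : α → β → ℝ≥0∞) (z : β) (δ : ℝ≥0∞), z ∈ C ∧ 0 < δ ∧
      (∀ a b, p a b ≠ 0 → R a b) ∧ (∀ a b, δ * n a b ≤ g a b) ∧
      (∀ a, ∑' b, p a b ≤ 1) ∧ (∀ b, ∑' a, p a b ≤ 1) ∧
      (∀ a, ∑' b, p a b = ∑' b, n a b + if a = y then 1 else 0) ∧
      (∀ b, ∑' a, p a b = ∑' a, n a b + if b = z then 1 else 0) ∧
      (∀ a, (∀ j ≤ k, ¬ ∃ b ∈ reachCol R g C j, R a b) → ∑' b, p a b = 0) ∧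
      (∀ b, (∀ j ≤ k, b ∉ reachCol R g C j) → ∑' a, p a b = 0) := by
  induction k with
  | zero =>
    rintro y ⟨z, hz, hyz⟩ -
    refine ⟨unitEntry y z, 0, z, 1, hz, one_pos, ?_, ?_, ?_, ?_, ?_, ?_, ?_, ?_⟩
    · intro a b h
      simp only [unitEntry, ne_eq, ite_eq_right_iff, one_ne_zero, imp_false, not_not] at h
      rw [h.1, h.2]; exact hyz
    · simp
    · intro a; rw [tsum_unitEntry_row]; split_ifs <;> simp
    · intro b; rw [tsum_unitEntry_col]; split_ifs <;> simp
    · intro a; simp [tsum_unitEntry_row]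
    · intro b; simp [tsum_unitEntry_col]
    · intro a h
      rw [tsum_unitEntry_row, if_neg]
      rintro rfl
      exact h 0 le_rfl ⟨z, hz, hyz⟩
    · intro b h
      rw [tsum_unitEntry_col, if_neg]
      rintro rfl
      exact h 0 le_rfl hz
  | succ k ih =>
    rintro y ⟨c, ⟨y', hgc, hy'⟩, hyc⟩ hmin
    have hy'min : ∀ j < k, ¬ ∃ b ∈ reachCol R g C j, R y' b := fun j hj hb =>
      hmin (j + 1) (by omega) ⟨c, ⟨y', hgc, hb⟩, hyc⟩
    obtain ⟨p, n, z, δ, hz, hδ, hpR, hng, hp1, hp1', hrow, hcol, hfr, hfc⟩ := ih y' hy' hy'min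
    have hpy : ∑' b, p y b = 0 := hfr y fun j hj => hmin j (by omega)
    have hpc : ∑' a, p a c = 0 := hfc c fun j hj hc => hmin j (by omega) ⟨c, hc, hyc⟩
    have hnc : ∀ a, n a c = 0 := by
      have := hcol c
      rw [hpc] at this
      exact ENNReal.tsum_eq_zero.1 (add_eq_zero.1 this.symm).1
    refine ⟨fun a b => p a b + unitEntry y c a b, fun a b => n a b + unitEntry y' c a b, z,
      min δ (g y' c), hz, lt_min hδ (pos_iff_ne_zero.2 hgc), ?_, ?_, ?_, ?_, ?_, ?_, ?_, ?_⟩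
    · intro a b h
      by_cases hab : a = y ∧ b = c
      · rw [hab.1, hab.2]; exact hyc
      · exact hpR a b (by simpa [unitEntry, hab] using h)
    · intro a b
      by_cases hab : a = y' ∧ b = c
      · rw [hab.1, hab.2]
        simp [unitEntry, hnc]
      · simp only [unitEntry, hab, if_false, add_zero]
        exact (mul_le_mul_left (min_le_left _ _) _).trans (hng a b)
    · intro a
      rw [ENNReal.tsum_add, tsum_unitEntry_row]
      by_cases ha : a = y
      · simp [ha, hpy]
      · simpa [ha] using hp1 a
    · intro b
      rw [ENNReal.tsum_add, tsum_unitEntry_col]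
      by_cases hb : b = c
      · simp [hb, hpc]
      · simpa [hb] using hp1' b
    · intro a
      rw [ENNReal.tsum_add, tsum_unitEntry_row, ENNReal.tsum_add, tsum_unitEntry_row, hrow]
    · intro b
      rw [ENNReal.tsum_add, tsum_unitEntry_col, ENNReal.tsum_add, tsum_unitEntry_col, hcol,
        add_right_comm]
    · intro a h
      have hay : a ≠ y := by
        rintro rfl
        exact h (k + 1) le_rfl ⟨c, ⟨y', hgc, hy'⟩, hyc⟩
      rw [ENNReal.tsum_add, tsum_unitEntry_row, if_neg hay, hfr a fun j hj => h j (by omega),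
        add_zero]
    · intro b h
      have hbc : b ≠ c := by
        rintro rfl
        exact h (k + 1) le_rfl ⟨y', hgc, hy'⟩
      rw [ENNReal.tsum_add, tsum_unitEntry_col, if_neg hbc, hfc b fun j hj => h j (by omega),
        add_zero]

/-- `g'` improves on `g`: the deficit has decreased by at least the weight gained by any rows and
by at least the weight lost on the edges of any column. -/
structure Improves (E : α → β → Prop) (X : Set α) (v : β → ℝ≥0∞) (g g' : α → β → ℝ≥0∞) :
    Prop where
  col_le : ∀ b, ∑' a, g a b ≤ ∑' a, g' a b
  loss_le : ∀ b, ∑' a, (g a b - g' a b) + deficit E X v g' ≤ deficit E X v g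
  gain_le : ∑' a, (∑' b, g' a b - ∑' b, g a b) + deficit E X v g' ≤ deficit E X v g

theorem Improves.refl (E : α → β → Prop) (X : Set α) (v : β → ℝ≥0∞) (g : α → β → ℝ≥0∞) :
    Improves E X v g g :=
  ⟨fun _ => le_rfl, fun _ => by simp, by simp⟩

theorem Improves.deficit_le {E : α → β → Prop} {X : Set α} {v : β → ℝ≥0∞} {g g' : α → β → ℝ≥0∞}
    (h : Improves E X v g g') : deficit E X v g' ≤ deficit E X v g :=
  le_add_self.trans h.gain_le

theorem Improves.trans {E : α → β → Prop} {X : Set α} {v : β → ℝ≥0∞}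
    {g₁ g₂ g₃ : α → β → ℝ≥0∞} (h : Improves E X v g₁ g₂) (h' : Improves E X v g₂ g₃) :
    Improves E X v g₁ g₃ := by
  refine ⟨fun b => (h.col_le b).trans (h'.col_le b), fun b => ?_, ?_⟩
  · calc _ ≤ ∑' a, ((g₁ a b - g₂ a b) + (g₂ a b - g₃ a b)) + deficit E X v g₃ := by
          gcongr; exact tsub_le_tsub_add_tsub
      _ ≤ _ := by
          rw [ENNReal.tsum_add, add_assoc]
          exact (add_le_add_right (h'.loss_le b) _).trans (h.loss_le b)
  · calc _ ≤ ∑' a, ((∑' b, g₂ a b - ∑' b, g₁ a b) + (∑' b, g₃ a b - ∑' b, g₂ a b))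
            + deficit E X v g₃ := by
          gcongr; rw [add_comm]; exact tsub_le_tsub_add_tsub
      _ ≤ _ := by
          rw [ENNReal.tsum_add, add_assoc]
          exact (add_le_add_right h'.gain_le _).trans h.gain_le

/-- Without a hindrance, a matrix of finite deficit that leaves some weight of `X` unused can be
improved strictly. -/
theorem exists_strict_improvement {E : α → β → Prop} {u : α → ℝ≥0∞} {v : β → ℝ≥0∞}
    (hu : ∀ a, u a ≠ ⊤) (hE : ¬ Hindrance E u v) {X : Set α} {g : α → β → ℝ≥0∞}
    (hg : Admissible E X u v g) (hfin : deficit E X v g ≠ ⊤) {x : α} (hx : x ∈ X)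
    (hlt : ∑' b, g x b < u x) :
    ∃ g', Admissible E X u v g' ∧ Improves E X v g g' ∧ deficit E X v g' < deficit E X v g := by
  set C : Set β := {b | b ∈ nbr E X ∧ ∑' a, g a b < v b} with hC
  set R : α → β → Prop := fun a b => a ∈ X ∧ E a b with hR
  obtain ⟨y, hy, hylt, k, hk⟩ : ∃ y ∈ X, ∑' b, g y b < u y ∧
      ∃ k, ∃ b ∈ reachCol R g C k, R y b := by
    by_contra! hno
    refine hE ⟨{y | y ∈ X ∧ ∀ k, ∀ b ∈ reachCol R g C k, ¬ R y b},
      fun a b => if ∀ k, ∀ b ∈ reachCol R g C k, ¬ R a b then g a b else 0,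
      ⟨?_, ?_, ?_⟩, ?_, x, ⟨hx, hno x hx hlt⟩, ?_⟩
    · intro a b h
      simp only [ne_eq, ite_eq_right_iff, Classical.not_imp] at h
      exact ⟨⟨(hg.supp a b h.2).1, h.1⟩, (hg.supp a b h.2).2⟩
    · intro a
      refine (ENNReal.tsum_le_tsum fun b => ?_).trans (hg.row_le a)
      split_ifs <;> simp
    · intro b
      refine (ENNReal.tsum_le_tsum fun a => ?_).trans (hg.col_le b)
      split_ifs <;> simp
    · rintro b ⟨a, ⟨haX, ha⟩, hab⟩
      have hsat : ∑' a, g a b = v b := by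
        refine (hg.col_le b).eq_of_not_lt fun h => ?_
        exact ha 0 b ⟨⟨a, haX, hab⟩, h⟩ ⟨haX, hab⟩
      rw [← hsat]
      refine tsum_congr fun a' => ?_
      beta_reduce
      split_ifs with h
      · rfl
      · push Not at h
        obtain ⟨k, c, hc, hac⟩ := h
        by_contra h0
        exact ha (k + 1) b ⟨a', Ne.symm h0, c, hc, hac⟩ ⟨haX, hab⟩
    · refine lt_of_le_of_lt (ENNReal.tsum_le_tsum fun b => ?_) hlt
      beta_reduce
      split_ifs <;> simp
  have hex : ∃ k, ∃ b ∈ reachCol R g C k, R y b := ⟨k, hk⟩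
  obtain ⟨p, n, z, δ₀, hz, hδ₀, hpR, hng, hp1, hp1', hrow, hcol, -, -⟩ :=
    exists_augmenting_direction R g C (Nat.find hex) y (Nat.find_spec hex)
      fun j hj => Nat.find_min hex hj
  obtain ⟨δ, hδpos, hδ₀', hδu, hδv⟩ : ∃ δ : ℝ≥0∞, 0 < δ ∧ δ ≤ δ₀ ∧ δ ≤ u y - ∑' b, g y b ∧
      δ ≤ v z - ∑' a, g a z :=
    ⟨min δ₀ (min (u y - ∑' b, g y b) (v z - ∑' a, g a z)),
      lt_min hδ₀ (lt_min (tsub_pos_of_lt hylt) (tsub_pos_of_lt hz.2)), min_le_left _ _,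
      (min_le_right _ _).trans (min_le_left _ _), (min_le_right _ _).trans (min_le_right _ _)⟩
  have hδtop : δ ≠ ⊤ := ne_top_of_le_ne_top (hu y) (hδu.trans tsub_le_self)
  have hδn : ∀ a b, δ * n a b ≤ g a b := fun a b => (by gcongr : _ ≤ δ₀ * n a b).trans (hng a b)
  set g' : α → β → ℝ≥0∞ := fun a b => g a b + δ * p a b - δ * n a b with hg'
  have hbal : ∀ a b, g' a b + δ * n a b = g a b + δ * p a b := fun a b =>
    tsub_add_cancel_of_le ((hδn a b).trans le_self_add)
  have hn1 : ∀ a, ∑' b, n a b ≤ 1 := fun a => le_self_add.trans ((hrow a).symm.trans_le (hp1 a))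
  have hn1' : ∀ b, ∑' a, n a b ≤ 1 := fun b => le_self_add.trans ((hcol b).symm.trans_le (hp1' b))
  have hrow' : ∀ a, ∑' b, g' a b = ∑' b, g a b + if a = y then δ else 0 := by
    intro a
    have h : ∑' b, _ = ∑' b, _ := tsum_congr (hbal a)
    rw [ENNReal.tsum_add, ENNReal.tsum_add, ENNReal.tsum_mul_left, ENNReal.tsum_mul_left, hrow,
      mul_add, add_comm (δ * _), ← add_assoc, ENNReal.add_left_inj
        (ENNReal.mul_ne_top hδtop (ne_top_of_le_ne_top ENNReal.one_ne_top (hn1 a)))] at h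
    rw [h]; split_ifs <;> simp
  have hcol' : ∀ b, ∑' a, g' a b = ∑' a, g a b + if b = z then δ else 0 := by
    intro b
    have h : ∑' a, _ = ∑' a, _ := tsum_congr fun a => hbal a b
    rw [ENNReal.tsum_add, ENNReal.tsum_add, ENNReal.tsum_mul_left, ENNReal.tsum_mul_left, hcol,
      mul_add, add_comm (δ * _), ← add_assoc, ENNReal.add_left_inj
        (ENNReal.mul_ne_top hδtop (ne_top_of_le_ne_top ENNReal.one_ne_top (hn1' b)))] at h
    rw [h]; split_ifs <;> simp
  have hdef : δ + deficit E X v g' ≤ deficit E X v g := by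
    have h1 : δ = ∑' b, if b = z then δ else 0 := by rw [tsum_ite_eq]
    rw [deficit, deficit]
    conv_lhs => rw [h1]
    rw [← ENNReal.tsum_add]
    refine ENNReal.tsum_le_tsum fun b => ?_
    rw [hcol']
    by_cases hb : b = z
    · subst hb
      simp only [if_true, hz.1]
      rw [← tsub_tsub, add_tsub_cancel_of_le hδv]
    · simp [hb]
  refine ⟨g', ⟨?_, ?_, ?_⟩, ⟨?_, ?_, ?_⟩, ?_⟩
  · intro a b h
    by_cases hgab : g a b = 0
    · refine hpR a b fun hp => h ?_
      simp [hg', hgab, hp]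
    · exact hg.supp a b hgab
  · intro a
    rw [hrow']
    split_ifs with h
    · subst h
      exact (add_le_add_right hδu _).trans_eq (add_tsub_cancel_of_le (hg.row_le a))
    · simpa using hg.row_le a
  · intro b
    rw [hcol']
    split_ifs with h
    · subst h
      exact (add_le_add_right hδv _).trans_eq (add_tsub_cancel_of_le (hg.col_le b))
    · simpa using hg.col_le b
  · intro b
    rw [hcol']
    exact le_self_add
  · intro b
    refine le_trans (add_le_add_left ?_ _) hdef
    calc ∑' a, (g a b - g' a b) ≤ ∑' a, δ * n a b := ENNReal.tsum_le_tsum fun a => by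
          rw [tsub_le_iff_left, hbal]; exact le_self_add
      _ ≤ δ := by
          rw [ENNReal.tsum_mul_left]
          exact mul_le_of_le_one_right' (hn1' b)
  · refine le_trans (add_le_add_left ?_ _) hdef
    calc _ ≤ ∑' a, (if a = y then δ else 0) := ENNReal.tsum_le_tsum fun a => by
          rw [tsub_le_iff_left, hrow']
      _ = δ := tsum_ite_eq _ _
  · have hfin' : deficit E X v g' ≠ ⊤ := ne_top_of_le_ne_top hfin (le_add_self.trans hdef)
    exact (ENNReal.lt_add_right hfin' hδpos.ne').trans_le (by rwa [add_comm])

theorem tsum_le_of_tendsto {ι γ : Type*} {l : Filter ι} [l.NeBot] {F : ι → γ → ℝ≥0∞}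
    {f : γ → ℝ≥0∞} {c : ℝ≥0∞} (hF : ∀ x, Filter.Tendsto (fun i => F i x) l (nhds (f x)))
    (hc : ∀ᶠ i in l, ∑' x, F i x ≤ c) : ∑' x, f x ≤ c := by
  rw [ENNReal.tsum_eq_iSup_sum]
  refine iSup_le fun s => le_of_tendsto (tendsto_finsetSum s fun x _ => hF x) ?_
  filter_upwards [hc] with i hi
  exact (ENNReal.sum_le_tsum s).trans hi

/-- A chain of improvements of a matrix of finite deficit has an upper bound. -/
theorem exists_upper_bound_of_chain {E : α → β → Prop} {u : α → ℝ≥0∞} {v : β → ℝ≥0∞}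
    (hu : ∀ a, u a ≠ ⊤) {X : Set α} {c : Set (α → β → ℝ≥0∞)} (hne : c.Nonempty)
    (hadm : ∀ g ∈ c, Admissible E X u v g) (hfin : ∀ g ∈ c, deficit E X v g ≠ ⊤)
    (hc : IsChain (Improves E X v) c) :
    ∃ g', Admissible E X u v g' ∧ ∀ g ∈ c, Improves E X v g g' := by
  have htot : ∀ g₁ ∈ c, ∀ g₂ ∈ c, ∃ g ∈ c, Improves E X v g₁ g ∧ Improves E X v g₂ g := by
    intro g₁ h₁ g₂ h₂
    by_cases h : g₁ = g₂
    · exact ⟨g₂, h₂, h ▸ Improves.refl _ _ _ _, Improves.refl _ _ _ _⟩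
    · rcases hc h₁ h₂ h with h | h
      · exact ⟨g₂, h₂, h, Improves.refl _ _ _ _⟩
      · exact ⟨g₁, h₁, Improves.refl _ _ _ _, h⟩
  set f : c → Filter (α → β → ℝ≥0∞) :=
    fun g => Filter.principal {h | h ∈ c ∧ Improves E X v g h} with hf
  have hnebot : (⨅ g, f g).NeBot := by
    have : Nonempty c := hne.to_subtype
    refine Filter.iInf_neBot_of_directed' ?_ ?_
    · rintro ⟨g₁, h₁⟩ ⟨g₂, h₂⟩
      obtain ⟨g, hg, h1, h2⟩ := htot g₁ h₁ g₂ h₂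
      refine ⟨⟨g, hg⟩, ?_, ?_⟩
      · exact Filter.principal_mono.2 fun h hh => ⟨hh.1, h1.trans hh.2⟩
      · exact Filter.principal_mono.2 fun h hh => ⟨hh.1, h2.trans hh.2⟩
    · rintro ⟨g, hg⟩
      exact Filter.principal_neBot_iff.2 ⟨g, hg, Improves.refl _ _ _ _⟩
  set l : Ultrafilter (α → β → ℝ≥0∞) := Ultrafilter.of (⨅ g, f g) with hl
  have hmem : ∀ g ∈ c, ∀ᶠ h in (l : Filter _), h ∈ c ∧ Improves E X v g h := fun g hg =>
    Ultrafilter.of_le _ (Filter.mem_iInf_of_mem ⟨g, hg⟩ (Filter.mem_principal_self _))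
  have hmemc : ∀ᶠ h in (l : Filter _), h ∈ c := by
    obtain ⟨g, hg⟩ := hne
    exact (hmem g hg).mono fun h hh => hh.1
  have hlim : ∀ F : (α → β → ℝ≥0∞) → ℝ≥0∞, ∃ x, Filter.Tendsto F l (nhds x) := fun F =>
    ⟨(l.map F).lim, Ultrafilter.le_nhds_lim _⟩
  choose g' hg' using fun a b => hlim fun h => h a b
  choose r hr using fun a => hlim fun h => ∑' b, h a b
  have hrow_r : ∀ a, ∑' b, g' a b ≤ r a := by
    intro a
    rw [ENNReal.tsum_eq_iSup_sum]
    refine iSup_le fun s => le_of_tendsto_of_tendsto' (tendsto_finsetSum s fun b _ => hg' a b)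
      (hr a) fun h => ENNReal.sum_le_tsum s
  have hadm' : Admissible E X u v g' := by
    refine ⟨fun a b h => ?_, fun a => ?_, fun b => ?_⟩
    · by_contra hno
      refine h (tendsto_nhds_unique (hg' a b) (tendsto_const_nhds.congr' ?_))
      filter_upwards [hmemc] with k hk
      by_contra h0
      exact hno ((hadm k hk).supp a b (Ne.symm h0))
    · exact tsum_le_of_tendsto (hg' a) (hmemc.mono fun h hh => (hadm h hh).row_le a)
    · exact tsum_le_of_tendsto (fun a => hg' a b) (hmemc.mono fun h hh => (hadm h hh).col_le b)
  have hentry : ∀ g ∈ c, ∀ a b, g a b ≠ ⊤ := fun g hg a b =>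
    ne_top_of_le_ne_top (hu a) ((ENNReal.le_tsum b).trans ((hadm g hg).row_le a))
  set D : ℝ≥0∞ := ⨅ g ∈ c, deficit E X v g with hD
  have hDle : ∀ g ∈ c, D ≤ deficit E X v g := fun g hg => iInf₂_le g hg
  have hDtop : D ≠ ⊤ := by
    obtain ⟨g, hg⟩ := hne
    exact ne_top_of_le_ne_top (hfin g hg) (hDle g hg)
  have hloss : ∀ g ∈ c, ∀ b, ∑' a, (g a b - g' a b) ≤ deficit E X v g - D := by
    intro g hg b
    refine tsum_le_of_tendsto (F := fun (h : α → β → ℝ≥0∞) a => g a b - h a b) (l := (l : Filter _))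
      (fun a => ENNReal.Tendsto.sub tendsto_const_nhds (hg' a b) (Or.inl (hentry g hg a b))) ?_
    filter_upwards [hmem g hg] with h hh
    exact ENNReal.le_sub_of_add_le_right hDtop
      ((add_le_add_right (hDle h hh.1) _).trans (hh.2.loss_le b))
  have hcol : ∀ g ∈ c, ∀ b, ∑' a, g a b ≤ ∑' a, g' a b := by
    intro g hg b
    refine ENNReal.le_of_forall_pos_le_add fun ε hε _ => ?_
    obtain ⟨k, hk, hkD⟩ : ∃ k ∈ c, deficit E X v k < D + ε := by
      have : D < D + ε := ENNReal.lt_add_right hDtop (by simpa using hε.ne')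
      rw [hD] at this
      simpa only [iInf_lt_iff, exists_prop] using this
    obtain ⟨m, hm, h1, h2⟩ := htot g hg k hk
    calc ∑' a, g a b ≤ ∑' a, m a b := h1.col_le b
      _ ≤ ∑' a, (g' a b + (m a b - g' a b)) := ENNReal.tsum_le_tsum fun a => le_add_tsub
      _ = ∑' a, g' a b + ∑' a, (m a b - g' a b) := ENNReal.tsum_add
      _ ≤ ∑' a, g' a b + ε := by
        gcongr
        refine (hloss m hm b).trans (tsub_le_iff_left.2 (h2.deficit_le.trans hkD.le))
  have hdef : ∀ g ∈ c, deficit E X v g' ≤ deficit E X v g := by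
    intro g hg
    refine ENNReal.tsum_le_tsum fun b => ?_
    split_ifs
    · exact tsub_le_tsub_left (hcol g hg b) _
    · rfl
  have hdefD : deficit E X v g' ≤ D := le_iInf₂ hdef
  refine ⟨g', hadm', fun g hg => ⟨hcol g hg, fun b => ?_, ?_⟩⟩
  · calc _ ≤ (deficit E X v g - D) + D := add_le_add (hloss g hg b) hdefD
      _ = _ := tsub_add_cancel_of_le (hDle g hg)
  · refine le_trans (add_le_add ?_ hdefD) (tsub_add_cancel_of_le (hDle g hg)).le
    refine le_trans (ENNReal.tsum_le_tsum fun a => tsub_le_tsub_right (hrow_r a) _) ?_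
    refine tsum_le_of_tendsto (F := fun (h : α → β → ℝ≥0∞) a => ∑' b, h a b - ∑' b, g a b)
      (l := (l : Filter _)) (fun a => ENNReal.Tendsto.sub (hr a) tendsto_const_nhds
        (Or.inr (ne_top_of_le_ne_top (hu a) ((hadm g hg).row_le a)))) ?_
    filter_upwards [hmem g hg] with h hh
    exact ENNReal.le_sub_of_add_le_right hDtop
      ((add_le_add_right (hDle h hh.1) _).trans hh.2.gain_le)

/-- Without a hindrance, all the weight missing on `X` can be added at the expense of the
deficit. -/
theorem exists_deficit_add_excess_le {E : α → β → Prop} {u : α → ℝ≥0∞} {v : β → ℝ≥0∞}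
    (hu : ∀ a, u a ≠ ⊤) (hE : ¬ Hindrance E u v) {X : Set α} {g : α → β → ℝ≥0∞}
    (hg : Admissible E X u v g) :
    ∃ g', Admissible E X u v g' ∧ deficit E X v g' + excess X u g ≤ deficit E X v g := by
  by_cases hfin : deficit E X v g = ⊤
  · exact ⟨g, hg, by rw [hfin]; exact le_top⟩
  obtain ⟨⟨m, hm, hgm⟩, hmax⟩ := exists_maximal_of_chains_bounded
    (α := {h // Admissible E X u v h ∧ Improves E X v g h})
    (r := fun h k => Improves E X v h.1 k.1) (fun c hc => by
      rcases c.eq_empty_or_nonempty with rfl | hne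
      · exact ⟨⟨g, hg, Improves.refl _ _ _ _⟩, by simp⟩
      obtain ⟨g', h1, h2⟩ := exists_upper_bound_of_chain (E := E) (v := v) hu
        (c := Subtype.val '' c) (hne.image _) (by rintro _ ⟨h, -, rfl⟩; exact h.2.1)
        (by rintro _ ⟨h, -, rfl⟩; exact ne_top_of_le_ne_top hfin h.2.2.deficit_le)
        (by
          rintro _ ⟨h, hh, rfl⟩ _ ⟨k, hk, rfl⟩ hne
          exact hc hh hk fun e => hne (congrArg _ e))
      obtain ⟨h, hh⟩ := hne
      exact ⟨⟨g', h1, h.2.2.trans (h2 _ ⟨h, hh, rfl⟩)⟩, fun k hk => h2 _ ⟨k, hk, rfl⟩⟩)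
    (fun h h' => h.trans h')
  have hfull : ∀ x ∈ X, ∑' b, m x b = u x := by
    intro x hx
    refine (hm.row_le x).eq_of_not_lt fun hlt => ?_
    obtain ⟨g', h1, h2, h3⟩ := exists_strict_improvement hu hE hm
      (ne_top_of_le_ne_top hfin hgm.deficit_le) hx hlt
    exact (hmax ⟨g', h1, hgm.trans h2⟩ h2).deficit_le.not_gt h3
  refine ⟨m, hm, ?_⟩
  rw [add_comm]
  refine le_trans (add_le_add_left (ENNReal.tsum_le_tsum fun a => ?_) _) hgm.gain_le
  split_ifs with ha
  · rw [hfull a ha]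
  · exact zero_le

theorem hallCondition_of_not_hindrance {E : α → β → Prop} {u : α → ℝ≥0∞} {v : β → ℝ≥0∞}
    (hu : ∀ a, u a ≠ ⊤) (hE : ¬ Hindrance E u v) : HallCondition E u v := fun _ _ hg => by
  obtain ⟨g', -, h⟩ := exists_deficit_add_excess_le hu hE hg
  exact le_add_self.trans h

/-- Countably many admissible matrices can be glued: each column is taken from the first set to
which it is adjacent. -/
theorem exists_glue {γ : Type*} {r : γ → ℕ} (hr : Function.Injective r) {E : α → β → Prop}
    {u : α → ℝ≥0∞} {v : β → ℝ≥0∞} {X : γ → Set α} {G : γ → α → β → ℝ≥0∞}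
    (hG : ∀ i, Admissible E (X i) u v (G i)) :
    ∃ g, Admissible E (⋃ i, X i) u v g ∧ ∀ i, ∀ b ∈ nbr E (X i),
      (∀ j, r j < r i → b ∉ nbr E (X j)) → ∑' a, g a b = ∑' a, G i a b := by
  set First : β → γ → Prop := fun b i => b ∈ nbr E (X i) ∧ ∀ j, r j < r i → b ∉ nbr E (X j)
    with hFirst
  have huniq : ∀ b i j, First b i → First b j → i = j := by
    intro b i j hi hj
    refine hr (le_antisymm (not_lt.1 fun h => ?_) (not_lt.1 fun h => ?_))
    · exact hi.2 j h hj.1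
    · exact hj.2 i h hi.1
  set g : α → β → ℝ≥0∞ := fun a b => if h : ∃ i, First b i then G h.choose a b else 0 with hg
  have hgG : ∀ a b i, First b i → g a b = G i a b := by
    intro a b i hi
    have h : ∃ i, First b i := ⟨i, hi⟩
    simp only [hg, dif_pos h, huniq b _ _ h.choose_spec hi]
  have hg0 : ∀ a b, g a b ≠ 0 → ∃ i, First b i := by
    intro a b h
    by_contra hno
    exact h (dif_neg hno)
  refine ⟨g, ⟨fun a b h => ?_, fun a => ?_, fun b => ?_⟩, fun i b hb hmin => ?_⟩
  · obtain ⟨i, hi⟩ := hg0 a b h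
    rw [hgG a b i hi] at h
    exact ⟨Set.mem_iUnion_of_mem i ((hG i).supp a b h).1, ((hG i).supp a b h).2⟩
  · by_cases ha : ∃ n i, r i = n ∧ a ∈ X i
    · obtain ⟨j, hj, haj⟩ := Nat.find_spec ha
      refine (ENNReal.tsum_le_tsum fun b => ?_).trans ((hG j).row_le a)
      by_cases h0 : g a b = 0
      · rw [h0]; exact zero_le
      obtain ⟨i, hi⟩ := hg0 a b h0
      have hs := (hG i).supp a b (by rwa [← hgG a b i hi])
      have hle : r j ≤ r i := hj.trans_le (Nat.find_min' ha ⟨i, rfl, hs.1⟩)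
      have hge : r i ≤ r j := not_lt.1 fun h => hi.2 j h ⟨a, haj, hs.2⟩
      rw [hgG a b i hi, hr (le_antisymm hge hle)]
    · refine (ENNReal.tsum_eq_zero.2 fun b => ?_).trans_le zero_le
      by_contra h0
      obtain ⟨i, hi⟩ := hg0 a b h0
      exact ha ⟨_, i, rfl, ((hG i).supp a b (by rwa [← hgG a b i hi])).1⟩
  · by_cases hb : ∃ i, First b i
    · obtain ⟨i, hi⟩ := hb
      rw [tsum_congr fun a => hgG a b i hi]
      exact (hG i).col_le b
    · refine (ENNReal.tsum_eq_zero.2 fun a => ?_).trans_le zero_le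
      by_contra h0
      exact hb (hg0 a b h0)
  · exact tsum_congr fun a => hgG a b i ⟨hb, hmin⟩

theorem exists_first {γ : Type*} (r : γ → ℕ) {p : γ → Prop} (h : ∃ i, p i) :
    ∃ i, p i ∧ ∀ j, r j < r i → ¬ p j := by
  have h' : ∃ n i, r i = n ∧ p i := h.imp' r fun i hi => ⟨i, rfl, hi⟩
  obtain ⟨i, hi, hpi⟩ := Nat.find_spec h'
  exact ⟨i, hpi, fun j hj hpj => Nat.find_min h' (hi ▸ hj) ⟨j, rfl, hpj⟩⟩

theorem Admissible.mono {E : α → β → Prop} {X Y : Set α} {u u' : α → ℝ≥0∞} {v v' : β → ℝ≥0∞}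
    {g : α → β → ℝ≥0∞} (hg : Admissible E X u v g) (hX : X ⊆ Y) (hu : u ≤ u') (hv : v ≤ v') :
    Admissible E Y u' v' g :=
  ⟨fun a b h => ⟨hX (hg.supp a b h).1, (hg.supp a b h).2⟩, fun a => (hg.row_le a).trans (hu a),
    fun b => (hg.col_le b).trans (hv b)⟩

theorem excess_mono {X : Set α} {u u' : α → ℝ≥0∞} (hu : u ≤ u') (g : α → β → ℝ≥0∞) :
    excess X u g ≤ excess X u' g :=
  ENNReal.tsum_le_tsum fun a => by
    split_ifs
    · exact tsub_le_tsub_right (hu a) _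
    · rfl

theorem tsub_tsub_le_add (x y z c : ℝ≥0∞) : x - z - c ≤ x - y - c + (y - z) := by
  rw [tsub_le_iff_right, tsub_le_iff_right]
  calc x ≤ x - y + y := le_tsub_add
    _ ≤ (x - y - c + c) + (y - z + z) := add_le_add le_tsub_add le_tsub_add
    _ = _ := by ring

theorem deficit_sub_le (E : α → β → Prop) (X : Set α) (v φ ψ : β → ℝ≥0∞) (g : α → β → ℝ≥0∞) :
    deficit E X (v - φ) g ≤ deficit E X (v - ψ) g + ∑' b, (ψ b - φ b) := by
  rw [deficit, deficit, ← ENNReal.tsum_add]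
  refine ENNReal.tsum_le_tsum fun b => ?_
  split_ifs
  · exact tsub_tsub_le_add _ _ _ _
  · exact zero_le

/-- If lowering the weights of `a` and of its neighbour `b` violates Hall's condition, then some
set avoiding `a` and adjacent to `b` can be given a small deficit. -/
theorem exists_small_deficit {E : α → β → Prop} {u : α → ℝ≥0∞} {v : β → ℝ≥0∞}
    (hu : ∀ a, u a ≠ ⊤) (hH : HallCondition E u v) {a : α} {b : β} (hab : E a b) {ε : ℝ≥0∞}
    (hεu : ε ≤ u a) (hεv : ε ≤ v b)
    (hno : ¬ HallCondition E (u - Pi.single a ε) (v - Pi.single b ε)) :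
    ∃ X g, Admissible E X u v g ∧ a ∉ X ∧ b ∈ nbr E X ∧ deficit E X v g ≤ ε := by
  have hεtop : ε ≠ ⊤ := ne_top_of_le_ne_top (hu a) hεu
  simp only [HallCondition, not_forall, not_le] at hno
  obtain ⟨X, g, hg', hlt⟩ := hno
  have hg : Admissible E X u v g := hg'.mono subset_rfl tsub_le_self tsub_le_self
  have hexc : excess X (u - Pi.single a ε) g ≤ excess X u g := excess_mono tsub_le_self g
  have hdef : deficit E X v g ≤ deficit E X (v - Pi.single b ε) g + ε := by
    have := deficit_sub_le E X v 0 (Pi.single b ε) g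
    simpa using this
  have ha : a ∉ X := by
    intro ha
    have h1 : ε + excess X (u - Pi.single a ε) g ≤ excess X u g := by
      have h1 : ∑' x, (if x = a then ε else 0) = ε := tsum_ite_eq _ _
      refine (congrArg (· + _) h1.symm).trans_le ?_
      rw [excess, excess, ← ENNReal.tsum_add]
      refine ENNReal.tsum_le_tsum fun x => ?_
      by_cases hx : x = a
      · subst hx
        have := hg'.row_le x
        simp only [Pi.sub_apply, Pi.single_eq_same] at this
        simp only [if_true, ha, Pi.sub_apply, Pi.single_eq_same]
        rw [tsub_right_comm, add_tsub_cancel_of_le]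
        exact ENNReal.le_sub_of_add_le_right (ne_top_of_le_ne_top (hu x) (hg.row_le x))
          ((add_le_add_right this _).trans_eq (add_tsub_cancel_of_le hεu))
      · simp [hx]
    have h2 := h1.trans ((hH X g hg).trans hdef)
    rw [add_comm] at h2
    exact hlt.not_ge ((ENNReal.add_le_add_iff_right hεtop).1 h2)
  have hb : b ∈ nbr E X := by
    by_contra hb
    refine hlt.not_ge (hexc.trans ((hH X g hg).trans (ENNReal.tsum_le_tsum fun c => ?_)))
    by_cases hc : c = b
    · subst hc; simp [hb]
    · simp [hc]
  obtain ⟨g₂, hg₂, h⟩ := exists_deficit_add_excess_le hu hH.not_hindrance hg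
  refine ⟨X, g₂, hg₂, ha, hb, ?_⟩
  have h3 : deficit E X v g₂ + deficit E X (v - Pi.single b ε) g
      ≤ ε + deficit E X (v - Pi.single b ε) g :=
    ((add_le_add_right (hlt.le.trans hexc) _).trans (h.trans hdef)).trans_eq (add_comm _ _)
  exact (ENNReal.add_le_add_iff_right (ne_top_of_lt hlt)).1 h3

/-- Under Hall's condition, a positive amount can be sent out of any vertex of positive weight,
keeping Hall's condition. -/
theorem exists_hallCondition_sub_single [Countable β] {E : α → β → Prop} {u : α → ℝ≥0∞}
    {v : β → ℝ≥0∞} (hu : ∀ a, u a ≠ ⊤) (hH : HallCondition E u v) {a : α} (ha : u a ≠ 0) :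
    ∃ b ε, E a b ∧ 0 < ε ∧ ε ≤ u a ∧ ε ≤ v b ∧
      HallCondition E (u - Pi.single a ε) (v - Pi.single b ε) := by
  by_contra! hno
  obtain ⟨η, hη, hηsum⟩ := ENNReal.exists_pos_sum_of_countable' ha β
  have hex : ∀ b, ∃ X g, Admissible E X u v g ∧ a ∉ X ∧ (E a b → v b ≠ 0 → b ∈ nbr E X) ∧
      deficit E X v g ≤ η b := by
    intro b
    by_cases hb : E a b ∧ v b ≠ 0
    · obtain ⟨X, g, hg, h1, h2, h3⟩ := exists_small_deficit hu hH hb.1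
        (ε := min (η b) (min (u a) (v b))) ((min_le_right _ _).trans (min_le_left _ _))
        ((min_le_right _ _).trans (min_le_right _ _))
        (hno b _ hb.1 (lt_min (hη b) (lt_min (pos_iff_ne_zero.2 ha) (pos_iff_ne_zero.2 hb.2)))
          ((min_le_right _ _).trans (min_le_left _ _))
          ((min_le_right _ _).trans (min_le_right _ _)))
      exact ⟨X, g, hg, h1, fun _ _ => h2, h3.trans (min_le_left _ _)⟩
    · refine ⟨∅, 0, ⟨by simp, by simp, by simp⟩, by simp, fun h h' => absurd ⟨h, h'⟩ hb, ?_⟩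
      simp [deficit, nbr]
  choose X G hG haX hbX hdef using hex
  have hcode := Encodable.ofCountable β
  obtain ⟨g, hg, hcol⟩ := exists_glue (Encodable.encode_injective (α := β)) hG
  have hrow : ∑' b, g a b = 0 := by
    refine ENNReal.tsum_eq_zero.2 fun b => ?_
    by_contra h0
    obtain ⟨i, hi⟩ := Set.mem_iUnion.1 (hg.supp a b h0).1
    exact haX i hi
  have h1 : u a ≤ excess (insert a (⋃ b, X b)) u g := by
    refine le_trans ?_ (ENNReal.le_tsum a)
    simp [hrow]
  have h2 : deficit E (insert a (⋃ b, X b)) v g ≤ ∑' b, η b := by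
    calc _ ≤ ∑' b, ∑' i, (if b ∈ nbr E (X i) then v b - ∑' a, G i a b else 0) := by
          refine ENNReal.tsum_le_tsum fun b => ?_
          split_ifs with hb
          · by_cases hv : v b = 0
            · simp [hv]
            have hb' : ∃ i, b ∈ nbr E (X i) := by
              obtain ⟨x, hx | hx, hxb⟩ := hb
              · subst hx
                exact ⟨b, hbX b hxb hv⟩
              · obtain ⟨i, hi⟩ := Set.mem_iUnion.1 hx
                exact ⟨i, x, hi, hxb⟩
            obtain ⟨i, hi, hmin⟩ := exists_first Encodable.encode hb'
            rw [hcol i b hi hmin]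
            refine le_trans ?_ (ENNReal.le_tsum i)
            rw [if_pos hi]
          · exact zero_le
      _ = ∑' i, deficit E (X i) v (G i) := ENNReal.tsum_comm
      _ ≤ _ := ENNReal.tsum_le_tsum hdef
  exact hηsum.not_ge (h1.trans ((hH _ g (hg.mono (Set.subset_insert _ _) le_rfl le_rfl)).trans h2))

theorem tsum_iSup_of_isChain {c : Set (β → ℝ≥0∞)} (hc : IsChain (· ≤ ·) c) :
    ∑' b, ⨆ φ : c, φ.1 b = ⨆ φ : c, ∑' b, φ.1 b := by
  refine le_antisymm ?_ (iSup_le fun φ => ENNReal.tsum_le_tsum fun b =>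
    le_iSup (fun φ : c => φ.1 b) φ)
  rw [ENNReal.tsum_eq_iSup_sum]
  refine iSup_le fun s => ?_
  rw [ENNReal.finsetSum_iSup]
  · exact iSup_mono fun φ => ENNReal.sum_le_tsum s
  · intro φ ψ
    rcases hc.total φ.2 ψ.2 with h | h
    · exact ⟨ψ, fun b => ⟨h b, le_rfl⟩⟩
    · exact ⟨φ, fun b => ⟨le_rfl, h b⟩⟩

/-- Under Hall's condition, the whole weight of a vertex can be sent out, keeping Hall's
condition. -/
theorem exists_hallCondition_sub [Countable β] {E : α → β → Prop} {u : α → ℝ≥0∞}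
    {v : β → ℝ≥0∞} (hu : ∀ a, u a ≠ ⊤) (hH : HallCondition E u v) (a : α) :
    ∃ φ : β → ℝ≥0∞, (∀ b, φ b ≠ 0 → E a b) ∧ φ ≤ v ∧ ∑' b, φ b = u a ∧
      HallCondition E (u - Pi.single a (u a)) (v - φ) := by
  set T : Set (β → ℝ≥0∞) := {φ | (∀ b, φ b ≠ 0 → E a b) ∧ φ ≤ v ∧ ∑' b, φ b ≤ u a ∧
    HallCondition E (u - Pi.single a (∑' b, φ b)) (v - φ)} with hT
  obtain ⟨φ, ⟨hsupp, hle, hsum, hHall⟩, hmax⟩ : ∃ φ, Maximal (· ∈ T) φ := by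
    refine zorn_le₀ T fun c hcT hc => ?_
    rcases c.eq_empty_or_nonempty with rfl | hne
    · refine ⟨0, ⟨by simp, zero_le, by simp, ?_⟩, by simp⟩
      simpa using hH
    have hsup := tsum_iSup_of_isChain hc
    have hleΦ : ∀ φ ∈ c, φ ≤ fun b => ⨆ φ : c, φ.1 b := fun φ hφ b =>
      le_iSup (fun φ : c => φ.1 b) ⟨φ, hφ⟩
    have hsumle : ∑' b, ⨆ φ : c, φ.1 b ≤ u a := hsup.trans_le (iSup_le fun φ => (hcT φ.2).2.2.1)
    have htop := ne_top_of_le_ne_top (hu a) hsumle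
    refine ⟨fun b => ⨆ φ : c, φ.1 b, ⟨fun b hb => ?_, fun b => ?_, hsumle, ?_⟩, hleΦ⟩
    · by_contra hab
      refine hb (le_antisymm (iSup_le fun φ => ?_) zero_le)
      by_contra h0
      exact hab ((hcT φ.2).1 b fun h => h0 h.le)
    · exact iSup_le fun φ => (hcT φ.2).2.1 b
    · intro X g hg
      refine ENNReal.le_of_forall_pos_le_add fun ε hε _ => ?_
      obtain ⟨φ, hφ⟩ : ∃ φ : c, ∑' b, ⨆ φ : c, φ.1 b ≤ ∑' b, φ.1 b + ε := by
        by_contra! h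
        have : Nonempty c := hne.to_subtype
        have h1 : (⨆ φ : c, ∑' b, φ.1 b) + ε ≤ ∑' b, ⨆ φ : c, φ.1 b := by
          rw [ENNReal.iSup_add]
          exact iSup_le fun φ => (h φ).le
        rw [← hsup] at h1
        exact h1.not_gt (ENNReal.lt_add_right htop (by simpa using hε.ne'))
      have hφle : ∑' b, φ.1 b ≤ ∑' b, ⨆ φ : c, φ.1 b := ENNReal.tsum_le_tsum (hleΦ φ.1 φ.2)
      have hsing : u - Pi.single a (∑' b, ⨆ φ : c, φ.1 b) ≤ u - Pi.single a (∑' b, φ.1 b) :=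
        tsub_le_tsub_left (Pi.single_mono a hφle) _
      have hg' : Admissible E X (u - Pi.single a (∑' b, φ.1 b)) (v - φ.1) g :=
        hg.mono subset_rfl hsing (tsub_le_tsub_left (hleΦ φ.1 φ.2) _)
      refine (excess_mono hsing g).trans (((hcT φ.2).2.2.2 X g hg').trans
        ((deficit_sub_le E X v φ.1 _ g).trans (add_le_add_right ?_ _)))
      refine (ENNReal.add_le_add_iff_left (ne_top_of_le_ne_top htop hφle)).1 (le_trans ?_ hφ)
      rw [← ENNReal.tsum_add]
      exact ENNReal.tsum_le_tsum fun b => (add_tsub_cancel_of_le (hleΦ φ.1 φ.2 b)).le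
  refine ⟨φ, hsupp, hle, ?_⟩
  have heq : ∑' b, φ b = u a := by
    refine hsum.eq_of_not_lt fun hlt => ?_
    have hpos : (u - Pi.single a (∑' b, φ b) : α → ℝ≥0∞) a ≠ 0 := by
      simpa only [Pi.sub_apply, Pi.single_eq_same] using (tsub_pos_of_lt hlt).ne'
    obtain ⟨b, ε, hab, hε, hεu, hεv, hHall'⟩ := exists_hallCondition_sub_single
      (fun x => ne_top_of_le_ne_top (hu x) tsub_le_self) hHall hpos
    have hsum' : ∑' c, (φ + Pi.single b ε : β → ℝ≥0∞) c = ∑' c, φ c + ε := by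
      simp [ENNReal.tsum_add]
    have hmem : φ + Pi.single b ε ∈ T := by
      refine ⟨fun c hc => ?_, fun c => ?_, ?_, ?_⟩
      · by_cases hcb : c = b
        · exact hcb ▸ hab
        · exact hsupp c (by simpa [hcb] using hc)
      · by_cases hcb : c = b
        · subst hcb
          simp only [Pi.sub_apply] at hεv
          simpa using (add_le_add_right hεv (φ c)).trans_eq (add_tsub_cancel_of_le (hle c))
        · simpa [hcb] using hle c
      · rw [hsum']
        simp only [Pi.single_eq_same] at hεu
        exact (add_le_add_right hεu _).trans_eq (add_tsub_cancel_of_le hsum)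
      · rw [hsum', Pi.single_add, ← tsub_tsub, ← tsub_tsub]
        exact hHall'
    have h1 := hmax hmem (le_self_add) b
    simp only [Pi.add_apply, Pi.single_eq_same] at h1
    have hφb : φ b ≠ ⊤ := ne_top_of_le_ne_top (hu a) ((ENNReal.le_tsum b).trans hsum)
    exact h1.not_gt (ENNReal.lt_add_right hφb hε.ne')
  exact ⟨heq, heq ▸ hHall⟩

/-- A countable weighted bipartite graph without a hindrance has a matrix saturating all rows. -/
theorem exists_saturating [Countable α] [Countable β] {E : α → β → Prop} {u : α → ℝ≥0∞}
    {v : β → ℝ≥0∞} (hu : ∀ a, u a ≠ ⊤) (hE : ¬ Hindrance E u v) :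
    ∃ h, Admissible E Set.univ u v h ∧ ∀ a, ∑' b, h a b = u a := by
  have hcode := Encodable.ofCountable α
  have hstep : ∀ (n : ℕ) (p : {p : (α → ℝ≥0∞) × (β → ℝ≥0∞) //
      p.1 ≤ u ∧ HallCondition E p.1 p.2}), ∃ (φ : β → ℝ≥0∞)
      (q : {p : (α → ℝ≥0∞) × (β → ℝ≥0∞) // p.1 ≤ u ∧ HallCondition E p.1 p.2}),
      φ ≤ p.1.2 ∧ q.1.2 = p.1.2 - φ ∧
      (∀ a, Encodable.encode a = n → (∀ b, φ b ≠ 0 → E a b) ∧ ∑' b, φ b = p.1.1 a) ∧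
      ∀ a, Encodable.encode a ≠ n → q.1.1 a = p.1.1 a := by
    rintro n ⟨⟨u', v'⟩, hle, hH⟩
    by_cases hn : ∃ a : α, Encodable.encode a = n
    · obtain ⟨a, rfl⟩ := hn
      obtain ⟨φ, h1, h2, h3, h4⟩ := exists_hallCondition_sub
        (fun x => ne_top_of_le_ne_top (hu x) (hle x)) hH a
      refine ⟨φ, ⟨(u' - Pi.single a (u' a), v' - φ), tsub_le_self.trans hle, h4⟩, h2, rfl, ?_, ?_⟩
      · intro a' ha'
        obtain rfl := Encodable.encode_injective ha'
        exact ⟨h1, h3⟩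
      · intro a' ha'
        have hne : a' ≠ a := fun h => ha' (h ▸ rfl)
        simp [hne]
    · exact ⟨0, ⟨(u', v'), hle, hH⟩, zero_le, by simp, fun a ha => absurd ⟨a, ha⟩ hn,
        fun _ _ => rfl⟩
  choose Φ next hΦle hnext hΦ hrest using hstep
  set p : ℕ → {p : (α → ℝ≥0∞) × (β → ℝ≥0∞) // p.1 ≤ u ∧ HallCondition E p.1 p.2} :=
    Nat.rec ⟨(u, v), le_rfl, hallCondition_of_not_hindrance hu hE⟩ next with hp
  have hpu : ∀ n, ∀ a : α, n ≤ Encodable.encode a → (p n).1.1 a = u a := by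
    intro n
    induction n with
    | zero => intro a _; rfl
    | succ n ih =>
      intro a ha
      exact (hrest n (p n) a (by omega)).trans (ih a (by omega))
  have hpv : ∀ n b, ∑ i ∈ Finset.range n, Φ i (p i) b + (p n).1.2 b = v b := by
    intro n b
    induction n with
    | zero => simp [hp]
    | succ n ih =>
      have h1 : (p (n + 1)).1.2 b = (p n).1.2 b - Φ n (p n) b := congrFun (hnext n (p n)) b
      rw [Finset.sum_range_succ, h1, add_assoc, add_tsub_cancel_of_le (hΦle n (p n) b), ih]
  refine ⟨fun a => Φ (Encodable.encode a) (p (Encodable.encode a)), ⟨fun a b h => ?_, fun a => ?_,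
    fun b => ?_⟩, fun a => ?_⟩
  · exact ⟨trivial, (hΦ _ (p _) a rfl).1 b h⟩
  · exact ((hΦ _ (p _) a rfl).2.trans (hpu _ a le_rfl)).le
  · calc _ ≤ ∑' n, Φ n (p n) b :=
          ENNReal.tsum_comp_le_tsum_of_injective (Encodable.encode_injective (α := α))
            fun n => Φ n (p n) b
      _ ≤ v b := by
        rw [ENNReal.tsum_eq_iSup_nat]
        exact iSup_le fun n => le_self_add.trans_eq (hpv n b)
  · exact (hΦ _ (p _) a rfl).2.trans (hpu _ a le_rfl)

/-- `X` is the first side of a wave: its neighbours can be saturated from `X`. -/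
def Wave (E : α → β → Prop) (u : α → ℝ≥0∞) (v : β → ℝ≥0∞) (X : Set α) : Prop :=
  ∃ g, Admissible E X u v g ∧ ∀ b ∈ nbr E X, ∑' a, g a b = v b

theorem Wave.empty (E : α → β → Prop) (u : α → ℝ≥0∞) (v : β → ℝ≥0∞) : Wave E u v ∅ :=
  ⟨0, ⟨by simp, by simp, by simp⟩, by simp [nbr]⟩

theorem Wave.iUnion {γ : Type*} [Countable γ] {E : α → β → Prop} {u : α → ℝ≥0∞}
    {v : β → ℝ≥0∞} {X : γ → Set α} (hX : ∀ i, Wave E u v (X i)) : Wave E u v (⋃ i, X i) := by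
  choose G hG hsat using hX
  have hcode := Encodable.ofCountable γ
  obtain ⟨g, hg, hcol⟩ := exists_glue (Encodable.encode_injective (α := γ)) hG
  refine ⟨g, hg, ?_⟩
  rintro b ⟨a, ha, hab⟩
  obtain ⟨i, hi⟩ := Set.mem_iUnion.1 ha
  obtain ⟨j, hj, hmin⟩ := exists_first Encodable.encode
    (p := fun i => b ∈ nbr E (X i)) ⟨i, a, hi, hab⟩
  rw [hcol j b hj hmin, hsat j b hj]

theorem exists_largest_wave [Countable α] (E : α → β → Prop) (u : α → ℝ≥0∞) (v : β → ℝ≥0∞) :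
    ∃ X, Wave E u v X ∧ ∀ Y, Wave E u v Y → Y ⊆ X := by
  have hex : ∀ a : α, ∃ X, Wave E u v X ∧ ∀ Y, Wave E u v Y → a ∈ Y → a ∈ X := by
    intro a
    by_cases h : ∃ Y, Wave E u v Y ∧ a ∈ Y
    · exact h.imp fun Y hY => ⟨hY.1, fun _ _ _ => hY.2⟩
    · exact ⟨∅, Wave.empty E u v, fun Y hY ha => absurd ⟨Y, hY, ha⟩ h⟩
  choose X hX hmem using hex
  exact ⟨_, Wave.iUnion hX, fun Y hY a ha => Set.mem_iUnion_of_mem a (hmem a Y hY ha)⟩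

/-- König duality for countable weighted bipartite graphs: an orthogonal pair of a fractional
matching and a vertex cover. -/
theorem exists_matching_cover [Countable α] [Countable β] (E : α → β → Prop) {u : α → ℝ≥0∞}
    (v : β → ℝ≥0∞) (hu : ∀ a, u a ≠ ⊤) :
    ∃ (f : α → β → ℝ≥0∞) (P : Set α) (Q : Set β), Admissible E Set.univ u v f ∧
      (∀ a ∈ P, ∑' b, f a b = u a) ∧ (∀ b ∈ Q, ∑' a, f a b = v b) ∧
      (∀ a ∈ P, ∀ b ∈ Q, f a b = 0) ∧ ∀ a b, E a b → a ∈ P ∨ b ∈ Q := by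
  obtain ⟨X, ⟨f, hf, hfsat⟩, hmax⟩ := exists_largest_wave E u v
  set E' : α → β → Prop := fun a b => E a b ∧ a ∉ X ∧ b ∉ nbr E X with hE'
  have hno : ¬ Hindrance E' (fun a => if a ∈ X then 0 else u a) v := by
    rintro ⟨Y, g, hg, hgsat, a, haY, hlt⟩
    have haX : a ∉ X := fun h => by simp [h] at hlt
    have hgY : Admissible E (Y \ X) u v g := by
      refine ⟨fun x b h => ?_, fun x => (hg.row_le x).trans ?_, hg.col_le⟩
      · obtain ⟨h1, h2⟩ := hg.supp x b h
        exact ⟨⟨h1, h2.2.1⟩, h2.1⟩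
      · split_ifs <;> simp
    have hr : Function.Injective fun i : Bool => i.toNat := by
      rintro (_ | _) (_ | _) <;> simp
    obtain ⟨k, hk, hcol⟩ := exists_glue hr (E := E) (u := u) (v := v)
      (X := fun i : Bool => if i then Y \ X else X) (G := fun i => if i then g else f)
      (fun i => by cases i <;> simpa)
    have hwave : Wave E u v (⋃ i : Bool, if i then Y \ X else X) := by
      refine ⟨k, hk, ?_⟩
      rintro b ⟨x, hx, hxb⟩
      by_cases hb : b ∈ nbr E X
      · rw [hcol false b (by simpa using hb) (by simp)]
        simpa using hfsat b hb
      · have hxY : x ∈ Y ∧ x ∉ X := by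
          obtain ⟨i, hi⟩ := Set.mem_iUnion.1 hx
          cases i
          · exact absurd ⟨x, by simpa using hi, hxb⟩ hb
          · simpa using hi
        rw [hcol true b (by simpa using ⟨x, hxY, hxb⟩) (by simpa using hb)]
        simpa using hgsat b ⟨x, hxY.1, hxb, hxY.2, hb⟩
    exact haX (hmax _ hwave (Set.mem_iUnion_of_mem true (by simpa using ⟨haY, haX⟩)))
  obtain ⟨h, hh, hrow⟩ := exists_saturating (fun a => by split_ifs <;> simp [hu]) hno
  have hfrow : ∀ a ∉ X, ∑' b, f a b = 0 := fun a ha =>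
    ENNReal.tsum_eq_zero.2 fun b => by
      by_contra h0
      exact ha (hf.supp a b h0).1
  have hfcol : ∀ b ∉ nbr E X, ∑' a, f a b = 0 := fun b hb =>
    ENNReal.tsum_eq_zero.2 fun a => by
      by_contra h0
      exact hb ⟨a, hf.supp a b h0⟩
  have hhcol : ∀ b ∈ nbr E X, ∑' a, h a b = 0 := fun b hb =>
    ENNReal.tsum_eq_zero.2 fun a => by
      by_contra h0
      exact (hh.supp a b h0).2.2.2 hb
  refine ⟨fun a b => f a b + h a b, Xᶜ, nbr E X, ⟨fun a b h0 => ⟨trivial, ?_⟩, fun a => ?_,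
    fun b => ?_⟩, fun a ha => ?_, fun b hb => ?_, fun a ha b hb => ?_, fun a b hab => ?_⟩
  · by_cases hf0 : f a b = 0
    · exact (hh.supp a b fun h1 => h0 (by simp [hf0, h1])).2.1
    · exact (hf.supp a b hf0).2
  · rw [ENNReal.tsum_add, hrow]
    split_ifs with ha
    · simpa using hf.row_le a
    · simp [hfrow a ha]
  · rw [ENNReal.tsum_add]
    by_cases hb : b ∈ nbr E X
    · rw [hhcol b hb, add_zero]
      exact hf.col_le b
    · rw [hfcol b hb, zero_add]
      exact hh.col_le b
  · rw [ENNReal.tsum_add, hrow, hfrow a ha, if_neg ha, zero_add]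
  · rw [ENNReal.tsum_add, hhcol b hb, hfsat b hb, add_zero]
  · have h1 := ENNReal.tsum_eq_zero.1 (hfrow a ha) b
    have h2 := ENNReal.tsum_eq_zero.1 (hhcol b hb) a
    simp only [h1, h2, add_zero]
  · by_cases ha : a ∈ X
    · exact Or.inr ⟨a, ha, hab⟩
    · exact Or.inl ha

/-- If on `L` the row sums of `φ` are at most its column sums, then the columns in `L` can be
scaled down so that on `L` row sums and column sums agree. -/
theorem exists_balanced_of_row_le (φ : α → α → ℝ≥0∞) (L : Set α)
    (hfin : ∀ g ∈ L, ∑' e, φ e g ≠ ⊤) (hle : ∀ g ∈ L, ∑' e, φ g e ≤ ∑' e, φ e g) :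
    ∃ ψ : α → α → ℝ≥0∞, ψ ≤ φ ∧ (∀ g ∈ L, ∑' e, ψ g e = ∑' e, ψ e g) ∧
      ∀ g ∉ L, ∀ e, ψ e g = φ e g := by
  let T : (α → α → ℝ≥0∞) →o (α → α → ℝ≥0∞) :=
    ⟨fun ψ e g => if g ∈ L then φ e g * (∑' k, ψ g k / ∑' k, φ k g) else φ e g, by
      intro ψ ψ' h e g
      beta_reduce
      split_ifs
      · gcongr with k
        exact h g k
      · rfl⟩
  have hψ : ∀ e g, OrderHom.lfp T e g =
      if g ∈ L then φ e g * (∑' k, OrderHom.lfp T g k / ∑' k, φ k g) else φ e g := fun e g =>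
    (congrFun (congrFun T.map_lfp e) g).symm
  have hψφ : OrderHom.lfp T ≤ φ := by
    refine OrderHom.lfp_le T fun e g => ?_
    change (if g ∈ L then φ e g * (∑' k, φ g k / ∑' k, φ k g) else φ e g) ≤ φ e g
    split_ifs with hg
    · refine mul_le_of_le_one_right' ?_
      simp only [div_eq_mul_inv]
      rw [ENNReal.tsum_mul_right, ← div_eq_mul_inv]
      exact ENNReal.div_le_of_le_mul (by simpa using hle g hg)
    · rfl
  refine ⟨OrderHom.lfp T, hψφ, fun g hg => ?_, fun g hg e => by rw [hψ, if_neg hg]⟩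
  have h1 : ∑' e, OrderHom.lfp T e g = (∑' e, φ e g) * (∑' k, OrderHom.lfp T g k / ∑' k, φ k g) := by
    rw [← ENNReal.tsum_mul_right]
    exact tsum_congr fun e => by rw [hψ, if_pos hg]
  rw [h1]
  simp only [div_eq_mul_inv]
  rw [ENNReal.tsum_mul_right, ← div_eq_mul_inv]
  by_cases h0 : ∑' e, φ e g = 0
  · rw [h0, zero_mul]
    exact le_antisymm (((ENNReal.tsum_le_tsum (hψφ g)).trans (hle g hg)).trans_eq h0) zero_le
  · exact (ENNReal.mul_div_cancel h0 (hfin g hg)).symm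

/-- The transpose of `exists_balanced_of_row_le`. -/
theorem exists_balanced_of_col_le (φ : α → α → ℝ≥0∞) (L : Set α)
    (hfin : ∀ g ∈ L, ∑' e, φ g e ≠ ⊤) (hle : ∀ g ∈ L, ∑' e, φ e g ≤ ∑' e, φ g e) :
    ∃ ψ : α → α → ℝ≥0∞, ψ ≤ φ ∧ (∀ g ∈ L, ∑' e, ψ g e = ∑' e, ψ e g) ∧
      ∀ g ∉ L, ∀ e, ψ g e = φ g e := by
  obtain ⟨ψ, h1, h2, h3⟩ := exists_balanced_of_row_le (fun e g => φ g e) L hfin hle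
  exact ⟨fun e g => ψ g e, fun e g => h1 g e, fun g hg => (h2 g hg).symm, h3⟩

theorem tsum_add_diag {T : α → α → Prop} (hT : ∀ e, ¬ T e e) {f : α → α → ℝ≥0∞}
    (hf : ∀ e g, f e g ≠ 0 → e = g ∨ T e g) (e : α) :
    ∑' g, (if T e g then f e g else 0) + f e e = ∑' g, f e g := by
  have h1 : ∑' g, (if g = e then f e e else 0) = f e e := tsum_ite_eq _ _
  rw [← h1, ← ENNReal.tsum_add]
  refine tsum_congr fun g => ?_
  by_cases hg : g = e
  · subst hg; simp [hT]
  · by_cases h : T e g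
    · simp [hg, h]
    · have : f e g = 0 := by
        by_contra h0
        rcases hf e g h0 with h' | h'
        · exact hg h'.symm
        · exact h h'
      simp [hg, h, this]

/-- Weights on the transitions `T` between elements of capacity `c`, balanced on `M`, together
with an orthogonal cover of the transitions. -/
theorem exists_balanced_transitions [Countable α] {T : α → α → Prop} (hT : ∀ e, ¬ T e e)
    (M : Set α) {c : α → ℝ≥0∞} (hc : ∀ e, c e ≠ ⊤) :
    ∃ (ψ : α → α → ℝ≥0∞) (P Q : Set α), (∀ e g, ψ e g ≠ 0 → T e g) ∧
      (∀ e, ∑' g, ψ e g ≤ c e) ∧ (∀ g, ∑' e, ψ e g ≤ c g) ∧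
      (∀ e ∈ M, ∑' g, ψ e g = ∑' g, ψ g e) ∧
      (∀ e g, T e g → e ∈ P ∨ g ∈ Q) ∧ (∀ e ∈ M, e ∈ P ∨ e ∈ Q) ∧
      (∀ e ∈ P, (e ∈ M → e ∈ Q) → ∑' g, ψ e g = c e) ∧
      (∀ g ∈ Q, (g ∈ M → g ∈ P) → ∑' e, ψ e g = c g) ∧
      ∀ e g, ψ e g ≠ 0 → (e ∈ P ↔ g ∉ Q) := by
  obtain ⟨f, P, Q, hf, hP, hQ, hPQ, hcov⟩ := exists_matching_cover
    (fun e g => (e = g ∧ e ∈ M) ∨ T e g) c hc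
  have hf' : ∀ e g, f e g ≠ 0 → e = g ∨ T e g := fun e g h =>
    (hf.supp e g h).2.imp_left And.left
  set φ : α → α → ℝ≥0∞ := fun e g => if T e g then f e g else 0 with hφ
  have hrow : ∀ e, ∑' g, φ e g + f e e = ∑' g, f e g := tsum_add_diag hT hf'
  have hcol : ∀ e, ∑' g, φ g e + f e e = ∑' g, f g e :=
    tsum_add_diag (T := fun e g => T g e) hT (f := fun e g => f g e)
      fun e g h => (hf' g e h).imp_left Eq.symm
  have hdiag : ∀ e, e ∉ M → f e e = 0 := fun e he => by
    by_contra h0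
    rcases (hf.supp e e h0).2 with h | h
    · exact he h.2
    · exact hT e h
  have hftop : ∀ e, f e e ≠ ⊤ := fun e =>
    ne_top_of_le_ne_top (hc e) ((ENNReal.le_tsum e).trans (hf.row_le e))
  have hφPQ : ∀ e ∈ P, ∀ g ∈ Q, φ e g = 0 := fun e he g hg => by simp [hφ, hPQ e he g hg]
  have hMcov : ∀ e ∈ M, e ∈ P ∨ e ∈ Q := fun e he => hcov e e (Or.inl ⟨rfl, he⟩)
  have hφrow : ∀ e, ∑' g, φ e g ≤ c e := fun e => (le_self_add.trans_eq (hrow e)).trans (hf.row_le e)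
  have hφcol : ∀ e, ∑' g, φ g e ≤ c e := fun e => (le_self_add.trans_eq (hcol e)).trans (hf.col_le e)
  set φL : α → α → ℝ≥0∞ := fun e g => if e ∉ P ∧ g ∈ Q then φ e g else 0 with hφL
  set φR : α → α → ℝ≥0∞ := fun e g => if e ∈ P ∧ g ∉ Q then φ e g else 0 with hφR
  have hLle : φL ≤ φ := fun e g => by simp only [hφL]; split_ifs <;> simp
  have hRle : φR ≤ φ := fun e g => by simp only [hφR]; split_ifs <;> simp
  have hLcol : ∀ g ∈ Q, ∀ e, φL e g = φ e g := fun g hg e => by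
    by_cases he : e ∈ P
    · simp [hφL, he, hφPQ e he g hg]
    · simp [hφL, he, hg]
  have hRrow : ∀ e ∈ P, ∀ g, φR e g = φ e g := fun e he g => by
    by_cases hg : g ∈ Q
    · simp [hφR, hg, hφPQ e he g hg]
    · simp [hφR, he, hg]
  obtain ⟨ψL, hψL, hbalL, heqL⟩ := exists_balanced_of_row_le φL (M \ P)
    (fun e _ => ne_top_of_le_ne_top (hc e)
      ((ENNReal.tsum_le_tsum fun g => hLle g e).trans (hφcol e)))
    (fun e he => by
      have heQ : e ∈ Q := (hMcov e he.1).resolve_left he.2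
      rw [tsum_congr (hLcol e heQ)]
      refine (ENNReal.tsum_le_tsum (hLle e)).trans ((ENNReal.add_le_add_iff_right (hftop e)).1 ?_)
      rw [hrow, hcol, hQ e heQ]
      exact hf.row_le e)
  obtain ⟨ψR, hψR, hbalR, heqR⟩ := exists_balanced_of_col_le φR (M \ Q)
    (fun e _ => ne_top_of_le_ne_top (hc e)
      ((ENNReal.tsum_le_tsum (hRle e)).trans (hφrow e)))
    (fun e he => by
      have heP : e ∈ P := (hMcov e he.1).resolve_right he.2
      rw [tsum_congr (hRrow e heP)]
      refine (ENNReal.tsum_le_tsum fun g => hRle g e).trans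
        ((ENNReal.add_le_add_iff_right (hftop e)).1 ?_)
      rw [hrow, hcol, hP e heP]
      exact hf.col_le e)
  have hL0 : ∀ e g, ψL e g ≠ 0 → e ∉ P ∧ g ∈ Q := fun e g h => by
    by_contra hno
    exact h (le_antisymm ((hψL e g).trans_eq (if_neg hno)) zero_le)
  have hR0 : ∀ e g, ψR e g ≠ 0 → e ∈ P ∧ g ∉ Q := fun e g h => by
    by_contra hno
    exact h (le_antisymm ((hψR e g).trans_eq (if_neg hno)) zero_le)
  have hadd : ∀ e g, ψL e g + ψR e g ≤ φ e g := fun e g => by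
    by_cases he : e ∈ P
    · have : ψL e g = 0 := by
        by_contra h
        exact (hL0 e g h).1 he
      rw [this, zero_add]
      exact (hψR e g).trans (hRle e g)
    · have : ψR e g = 0 := by
        by_contra h
        exact he (hR0 e g h).1
      rw [this, add_zero]
      exact (hψL e g).trans (hLle e g)
  have hLrow0 : ∀ e ∈ P, ∑' g, ψL e g = 0 := fun e he => ENNReal.tsum_eq_zero.2 fun g => by
    by_contra h
    exact (hL0 e g h).1 he
  have hLcol0 : ∀ g ∉ Q, ∑' e, ψL e g = 0 := fun g hg => ENNReal.tsum_eq_zero.2 fun e => by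
    by_contra h
    exact hg (hL0 e g h).2
  have hRrow0 : ∀ e ∉ P, ∑' g, ψR e g = 0 := fun e he => ENNReal.tsum_eq_zero.2 fun g => by
    by_contra h
    exact he (hR0 e g h).1
  have hRcol0 : ∀ g ∈ Q, ∑' e, ψR e g = 0 := fun g hg => ENNReal.tsum_eq_zero.2 fun e => by
    by_contra h
    exact (hR0 e g h).2 hg
  have hdiag' : ∀ e, (e ∈ M → e ∈ P ∧ e ∈ Q) → f e e = 0 := fun e he => by
    by_cases heM : e ∈ M
    · exact hPQ e (he heM).1 e (he heM).2
    · exact hdiag e heM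
  have hsatP : ∀ e ∈ P, (e ∈ M → e ∈ Q) → ∑' g, (ψL e g + ψR e g) = c e := by
    intro e he heM
    rw [ENNReal.tsum_add, hLrow0 e he, zero_add, tsum_congr (heqR e fun h => h.2 (heM h.1)),
      tsum_congr (hRrow e he), ← hP e he, ← hrow e, hdiag' e fun h => ⟨he, heM h⟩, add_zero]
  have hsatQ : ∀ e ∈ Q, (e ∈ M → e ∈ P) → ∑' g, (ψL g e + ψR g e) = c e := by
    intro e he heM
    rw [ENNReal.tsum_add, hRcol0 e he, add_zero, tsum_congr (heqL e fun h => h.2 (heM h.1)),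
      tsum_congr (hLcol e he), ← hQ e he, ← hcol e, hdiag' e fun h => ⟨heM h, he⟩, add_zero]
  refine ⟨fun e g => ψL e g + ψR e g, P, Q, fun e g h => ?_,
    fun e => (ENNReal.tsum_le_tsum (hadd e)).trans (hφrow e),
    fun e => (ENNReal.tsum_le_tsum fun g => hadd g e).trans (hφcol e), fun e he => ?_,
    fun e g h => hcov e g (Or.inr h), hMcov, hsatP, hsatQ, fun e g h => ?_⟩
  · by_contra hno
    exact h (le_antisymm ((hadd e g).trans_eq (if_neg hno)) zero_le)
  · by_cases heP : e ∈ P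
    · by_cases heQ : e ∈ Q
      · exact (hsatP e heP fun _ => heQ).trans (hsatQ e heQ fun _ => heP).symm
      · rw [ENNReal.tsum_add, ENNReal.tsum_add, hLrow0 e heP, hLcol0 e heQ, hbalR e ⟨he, heQ⟩]
    · have heQ : e ∈ Q := (hMcov e he).resolve_left heP
      rw [ENNReal.tsum_add, ENNReal.tsum_add, hRrow0 e heP, hRcol0 e heQ, hbalL e ⟨he, heP⟩]
  · by_cases h0 : ψL e g = 0
    · have := hR0 e g fun h1 => h (by simp [h0, h1])
      tauto
    · have := hL0 e g h0
      tauto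

end BipartiteWeb

theorem stmt10 [Countable V] (N : Network V) :
    ∃ (f : V × V → ℝ≥0) (S : Set V), IsFlow N f ∧ IsCut N S ∧ Orthogonal N f S := by
  set T : V × V → V × V → Prop := fun e g => e ∈ N.E ∧ g ∈ N.E ∧ e.2 = g.1 with hT
  set M : Set (V × V) := {e | e ∈ N.E ∧ e.1 ≠ N.s ∧ e.2 ≠ N.t} with hM
  have hloop : ∀ e ∈ N.E, e.2 ≠ e.1 := by
    rintro ⟨x, y⟩ he (rfl : y = x)
    exact N.loopless y he
  obtain ⟨ψ, P, Q, hsupp, hrow, hcol, hbal, hcov, hMcov, hsatP, hsatQ, hPQ⟩ :=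
    BipartiteWeb.exists_balanced_transitions (T := T) (fun e h => hloop e h.1 h.2.2) M
      (c := fun e => (N.c e : ℝ≥0∞)) fun e => ENNReal.coe_ne_top
  have hs : ∀ e ∈ N.E, e.2 ≠ N.s := by
    rintro ⟨x, y⟩ he (rfl : y = N.s)
    exact N.no_in_s x he
  have ht : ∀ e ∈ N.E, e.1 ≠ N.t := by
    rintro ⟨x, y⟩ he (rfl : x = N.t)
    exact N.no_out_t y he
  set F : V × V → ℝ≥0∞ := fun e => if e ∉ N.E then 0 else if e.2 ≠ N.t then ∑' g, ψ e g else
    if e.1 ≠ N.s then ∑' g, ψ g e else N.c e with hF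
  have hFc : ∀ e, F e ≤ N.c e := by
    intro e
    simp only [hF]
    split_ifs
    · exact hrow e
    · exact hcol e
    · exact le_rfl
    · exact zero_le
  have hcoe : ∀ e, ((F e).toNNReal : ℝ≥0∞) = F e := fun e =>
    ENNReal.coe_toNNReal (ne_top_of_le_ne_top ENNReal.coe_ne_top (hFc e))
  have hrow0 : ∀ e ∉ N.E, ∑' g, ψ e g = 0 := fun e he => ENNReal.tsum_eq_zero.2 fun g => by
    by_contra h
    exact he (hsupp e g h).1
  have hcol0 : ∀ e ∉ N.E, ∑' g, ψ g e = 0 := fun e he => ENNReal.tsum_eq_zero.2 fun g => by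
    by_contra h
    exact he (hsupp g e h).2.1
  have hFrow : ∀ e, e.2 ≠ N.t → F e = ∑' g, ψ e g := by
    intro e he
    by_cases heE : e ∈ N.E
    · simp [hF, heE, he]
    · simp [hF, heE, hrow0 e heE]
  have hFcol : ∀ e, e.1 ≠ N.s → F e = ∑' g, ψ g e := by
    intro e he
    by_cases heE : e ∈ N.E
    · by_cases het : e.2 = N.t
      · simp [hF, heE, het, he]
      · rw [hFrow e het]
        exact hbal e ⟨heE, he, het⟩
    · simp [hF, heE, hcol0 e heE]
  set S : Set V := {x | x = N.s ∨ x ≠ N.t ∧ ∃ e ∈ N.E, e.2 = x ∧ e ∉ P} with hS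
  have hSQ : ∀ e ∈ N.E, e.1 ∈ S → e.1 ≠ N.s → e ∈ Q := by
    rintro e he (h | ⟨-, e₀, he₀, h1, h2⟩) hes
    · exact absurd h hes
    · exact (hcov e₀ e ⟨he₀, he, h1⟩).resolve_left h2
  have hSP : ∀ e ∈ N.E, e.2 ∉ S → e.2 ≠ N.t → e ∈ P := by
    intro e he h het
    by_contra heP
    exact h (Or.inr ⟨het, e, he, rfl, heP⟩)
  refine ⟨fun e => (F e).toNNReal, S, ⟨fun e he => by simp [hF, he], fun e => ?_,
    fun x hxs hxt => ?_⟩, ⟨Or.inl rfl, ?_⟩, fun e he => ?_, fun e he => ?_⟩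
  · rw [← ENNReal.coe_le_coe, hcoe]
    exact hFc e
  · simp only [dplus, dminus, hcoe]
    have h1 : ∀ w, F (x, w) = ∑' v, ψ (v, x) (x, w) := by
      intro w
      rw [hFcol (x, w) hxs, ENNReal.tsum_prod']
      refine tsum_congr fun v => tsum_eq_single x fun y hy => ?_
      by_contra h
      exact hy (hsupp _ _ h).2.2
    have h2 : ∀ v, F (v, x) = ∑' w, ψ (v, x) (x, w) := by
      intro v
      rw [hFrow (v, x) hxt, ENNReal.tsum_prod']
      refine tsum_eq_single x fun y hy => ENNReal.tsum_eq_zero.2 fun w => ?_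
      by_contra h
      exact hy (hsupp _ _ h).2.2.symm
    simp only [h1, h2]
    exact ENNReal.tsum_comm
  · rintro (h | h)
    · exact N.ne h.symm
    · exact h.1 rfl
  · obtain ⟨heE, heS, heS'⟩ := he
    rw [← ENNReal.coe_inj, hcoe]
    by_cases het : e.2 = N.t
    · by_cases hes : e.1 = N.s
      · simp [hF, heE, het, hes]
      · rw [hFcol e hes]
        exact hsatQ e (hSQ e heE heS hes) fun h => absurd het h.2.2
    · rw [hFrow e het]
      exact hsatP e (hSP e heE heS' het) fun h => hSQ e heE heS h.2.1
  · obtain ⟨heE, heS, heS'⟩ := he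
    rw [← ENNReal.coe_inj, hcoe, ENNReal.coe_zero]
    have hes : e.1 ≠ N.s := fun h => heS (Or.inl h)
    obtain h | ⟨het, e₀, he₀, h1, h2⟩ := not_not.1 heS'
    · exact absurd h (hs e heE)
    by_cases heP : e ∈ P
    · rw [hFrow e het]
      refine ENNReal.tsum_eq_zero.2 fun g => ?_
      by_contra h
      obtain ⟨-, hgE, hg⟩ := hsupp e g h
      exact (hPQ e g h).1 heP ((hcov e₀ g ⟨he₀, hgE, h1.trans hg⟩).resolve_left h2)
    · have heQ : e ∈ Q := (hMcov e ⟨heE, hes, het⟩).resolve_left heP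
      rw [hFcol e hes]
      refine ENNReal.tsum_eq_zero.2 fun g => ?_
      by_contra h
      obtain ⟨hgE, -, hg⟩ := hsupp g e h
      have hgP : g ∉ P := fun hgP => (hPQ g e h).1 hgP heQ
      exact heS (Or.inr ⟨ht e heE, g, hgE, hg, hgP⟩)
end

section
/- Let Γ=(D,A,B,w) be a bipartite weighted web, u a nonnegative function on B with ε := Σ_{v∈B} u(v) finite, and let Γ' = (D,A,B,w') where w' agrees with w on A and w' = w − u on B. If Γ' contains a wave g together with a vertex a ∈ A not essential in TER(g) satisfying w'(a) − d⁺_g(a) > ε (a (>ε)-hindrance), then Γ contains a hindrance. -/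
open scoped ENNReal NNReal Classical

variable {V : Type}

/-- A Brezis–Browder principle: if increasing sequences are bounded, then some element cannot be
improved with respect to the bounded monotone function `φ`. -/
lemma exists_stable_of_seq_bounded {X : Type*} (r : X → X → Prop) (hrefl : ∀ x, r x x)
    (htrans : ∀ x y z, r x y → r y z → r x z) (φ : X → ℝ) (hφ : ∀ x y, r x y → φ x ≤ φ y)
    (K : ℝ) (hK : ∀ x, φ x ≤ K)
    (hseq : ∀ s : ℕ → X, (∀ m n, m ≤ n → r (s m) (s n)) → ∃ b, ∀ n, r (s n) b) (x₀ : X) :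
    ∃ x, ∀ y, r x y → φ y ≤ φ x := by
  have hbdd : ∀ x, BddAbove (φ '' {y | r x y}) := fun x => ⟨K, by rintro _ ⟨y, -, rfl⟩; exact hK y⟩
  have hnext : ∀ (n : ℕ) (x : X), ∃ y, r x y ∧
      sSup (φ '' {y | r x y}) - 1 / ((n : ℝ) + 1) < φ y := by
    intro n x
    have hpos : (0 : ℝ) < 1 / ((n : ℝ) + 1) := by positivity
    obtain ⟨_, ⟨y, hy, rfl⟩, h⟩ := exists_lt_of_lt_csSup (s := φ '' {y | r x y})
      ⟨_, x, hrefl x, rfl⟩ (sub_lt_self _ hpos)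
    exact ⟨y, hy, h⟩
  choose F hF1 hF2 using hnext
  let s : ℕ → X := fun n => Nat.rec x₀ F n
  have hs : ∀ m n, m ≤ n → r (s m) (s n) := by
    intro m n h
    induction n, h using Nat.le_induction with
    | base => exact hrefl _
    | succ n _ ih => exact htrans _ _ _ ih (hF1 n (s n))
  obtain ⟨b, hb⟩ := hseq s hs
  refine ⟨b, fun y hy => le_of_forall_pos_lt_add fun δ hδ => ?_⟩
  obtain ⟨n, hn⟩ := exists_nat_one_div_lt hδ
  have h1 : φ y ≤ sSup (φ '' {y | r (s n) y}) :=
    le_csSup (hbdd _) ⟨y, htrans _ _ _ (hb n) hy, rfl⟩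
  have h2 := hF2 n (s n)
  have h3 : φ (F n (s n)) ≤ φ b := hφ _ _ (hb (n + 1))
  linarith

lemma dplus_add_single (f : V × V → ℝ≥0) (e : V × V) (θ : ℝ≥0) (z : V) :
    dplus (fun d => f d + if d = e then θ else 0) z =
      dplus f z + if z = e.1 then (θ : ℝ≥0∞) else 0 := by
  obtain ⟨x, y⟩ := e
  simp only [dplus, ENNReal.coe_add, ENNReal.tsum_add, Prod.mk.injEq]
  congr 1
  by_cases h : z = x
  · simp [h, apply_ite ((↑) : ℝ≥0 → ℝ≥0∞)]
  · simp [h]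

lemma dminus_add_single (f : V × V → ℝ≥0) (e : V × V) (θ : ℝ≥0) (z : V) :
    dminus (fun d => f d + if d = e then θ else 0) z =
      dminus f z + if z = e.2 then (θ : ℝ≥0∞) else 0 := by
  obtain ⟨x, y⟩ := e
  simp only [dminus, ENNReal.coe_add, ENNReal.tsum_add, Prod.mk.injEq]
  congr 1
  by_cases h : z = y
  · simp [h, apply_ite ((↑) : ℝ≥0 → ℝ≥0∞)]
  · simp [h]

/-- The `ℓ¹` distance between the columns at `y` of two weightings of the edges. -/
noncomputable def colDist (f g : V × V → ℝ≥0) (y : V) : ℝ≥0∞ := ∑' x, edist (f (x, y)) (g (x, y))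

lemma colDist_triangle (f g h : V × V → ℝ≥0) (y : V) :
    colDist f h y ≤ colDist f g y + colDist g h y := by
  rw [colDist, colDist, colDist, ← ENNReal.tsum_add]
  exact ENNReal.tsum_le_tsum fun x => edist_triangle _ _ _

lemma NNReal.coe_le_add_edist (p q : ℝ≥0) : (p : ℝ≥0∞) ≤ q + edist p q := by
  rw [edist_nndist, ← ENNReal.coe_add, ENNReal.coe_le_coe, ← NNReal.coe_le_coe]
  push_cast
  rw [NNReal.dist_eq]
  linarith [le_abs_self ((p : ℝ) - q)]

lemma dminus_le_add_colDist (f g : V × V → ℝ≥0) (y : V) :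
    dminus f y ≤ dminus g y + colDist f g y := by
  rw [dminus, dminus, colDist, ← ENNReal.tsum_add]
  exact ENNReal.tsum_le_tsum fun x => NNReal.coe_le_add_edist _ _

lemma colDist_add_single (f : V × V → ℝ≥0) (e : V × V) (θ : ℝ≥0) (z : V) :
    colDist f (fun d => f d + if d = e then θ else 0) z = if z = e.2 then (θ : ℝ≥0∞) else 0 := by
  have h0 : dminus (fun _ : V × V => (0 : ℝ≥0)) z = 0 := by simp [dminus]
  have := dminus_add_single (fun _ => 0) e θ z
  rw [h0, zero_add] at this
  rw [← this, colDist, dminus]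
  refine tsum_congr fun x => ?_
  rw [edist_nndist, ENNReal.coe_inj, ← NNReal.coe_inj]
  simp [NNReal.dist_eq]

lemma colDist_comm (f g : V × V → ℝ≥0) (y : V) : colDist f g y = colDist g f y :=
  tsum_congr fun _ => edist_comm _ _

/-- `AltPath E f a S y`: there is an alternating path from `a` to `y`, whose forward edges lie in
`E`, whose backward edges carry positive `f`, and whose set of column vertices is `S`. -/
inductive AltPath (E : Set (V × V)) (f : V × V → ℝ≥0) (a : V) : Set V → V → Prop
  | base {y : V} : (a, y) ∈ E → AltPath E f a {y} y
  | step {S : Set V} {x y y' : V} : AltPath E f a S y → f (x, y) ≠ 0 → (x, y') ∈ E → y' ∉ S →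
      AltPath E f a (insert y' S) y'

lemma AltPath.mem {E : Set (V × V)} {f : V × V → ℝ≥0} {a : V} {S : Set V} {y : V}
    (h : AltPath E f a S y) : y ∈ S := by
  cases h <;> simp

lemma AltPath.exists_edge {E : Set (V × V)} {f : V × V → ℝ≥0} {a : V} {S : Set V} {y : V}
    (h : AltPath E f a S y) : ∃ x, (x, y) ∈ E := by
  cases h with
  | base h => exact ⟨_, h⟩
  | step _ _ h _ => exact ⟨_, h⟩

lemma AltPath.truncate {E : Set (V × V)} {f : V × V → ℝ≥0} {a : V} {S : Set V} {y : V}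
    (h : AltPath E f a S y) : ∀ z ∈ S, ∃ S', AltPath E f a S' z := by
  induction h with
  | base h => rintro z rfl; exact ⟨_, .base h⟩
  | step h h1 h2 h3 ih =>
    rintro z (rfl | hz)
    · exact ⟨_, .step h h1 h2 h3⟩
    · exact ih z hz

lemma AltPath.exists_extend {E : Set (V × V)} {f : V × V → ℝ≥0} {a : V} {S : Set V} {x y y' : V}
    (h : AltPath E f a S y) (hf : f (x, y) ≠ 0) (he : (x, y') ∈ E) : ∃ S', AltPath E f a S' y' := by
  by_cases hy : y' ∈ S
  · exact h.truncate _ hy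
  · exact ⟨_, .step h hf he hy⟩

/-- Augmentation of `f` along an alternating path. -/
lemma AltPath.exists_augment {E : Set (V × V)} {f : V × V → ℝ≥0} {a : V} {S : Set V} {y : V}
    (h : AltPath E f a S y) (hsupp : ∀ e, e ∉ E → f e = 0) :
    ∃ θ₀ : ℝ≥0, 0 < θ₀ ∧ ∀ θ ≤ θ₀, ∃ f' : V × V → ℝ≥0, (∀ e, e ∉ E → f' e = 0) ∧
      (∀ x, dplus f' x = dplus f x + if x = a then (θ : ℝ≥0∞) else 0) ∧
      (∀ z, dminus f' z = dminus f z + if z = y then (θ : ℝ≥0∞) else 0) ∧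
      (∀ x, f (x, y) ≤ f' (x, y)) ∧ (∀ z, z ∉ S → ∀ x, f' (x, z) = f (x, z)) ∧
      (∀ z, colDist f f' z ≤ 2 * θ) ∧ colDist f f' y ≤ θ := by
  induction h with
  | @base y h =>
    refine ⟨1, one_pos, fun θ _ => ⟨fun d => f d + if d = (a, y) then θ else 0, ?_, ?_, ?_, ?_, ?_,
      ?_, ?_⟩⟩
    · intro e he
      have : e ≠ (a, y) := fun h' => he (h' ▸ h)
      simp [this, hsupp e he]
    · exact dplus_add_single f (a, y) θ
    · exact dminus_add_single f (a, y) θ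
    · intro x; simp
    · intro z hz x
      have : z ≠ y := hz
      simp [this]
    · intro z
      rw [colDist_add_single]
      split_ifs
      · rw [two_mul]; exact le_self_add
      · simp
    · rw [colDist_add_single]; simp
  | @step S x y y' h hxy he hy' ih =>
    obtain ⟨θ₀, hθ₀, H⟩ := ih
    have hyy : y' ≠ y := fun h' => hy' (h' ▸ h.mem)
    refine ⟨min θ₀ (f (x, y)), lt_min hθ₀ (pos_iff_ne_zero.mpr hxy), fun θ hθ => ?_⟩
    obtain ⟨f₁, h1, h2, h3, h4, h5, h6, h7⟩ := H θ (hθ.trans (min_le_left _ _))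
    have hle : θ ≤ f₁ (x, y) := (hθ.trans (min_le_right _ _)).trans (h4 x)
    set f₂ : V × V → ℝ≥0 := fun d => f₁ d - if d = (x, y) then θ else 0 with hf₂
    have hback : (fun d => f₂ d + if d = (x, y) then θ else 0) = f₁ := by
      funext d
      refine tsub_add_cancel_of_le ?_
      split_ifs with hd
      · rw [hd]; exact hle
      · simp
    have hp := dplus_add_single f₂ (x, y) θ
    have hm := dminus_add_single f₂ (x, y) θ
    have hc := colDist_add_single f₂ (x, y) θ
    rw [hback] at hp hm hc
    have hcol : ∀ z, colDist f (fun d => f₂ d + if d = (x, y') then θ else 0) z ≤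
        colDist f f₁ z + ((if z = y then (θ : ℝ≥0∞) else 0) + if z = y' then (θ : ℝ≥0∞) else 0) := by
      intro z
      refine (colDist_triangle _ f₁ _ z).trans (add_le_add_right ?_ _)
      refine (colDist_triangle _ f₂ _ z).trans (le_of_eq ?_)
      rw [colDist_comm, hc, colDist_add_single]
    have hzero : colDist f f₁ y' = 0 := by simp [colDist, h5 y' hy']
    have hy'θ : colDist f (fun d => f₂ d + if d = (x, y') then θ else 0) y' ≤ θ := by
      simpa [hzero, hyy] using hcol y'
    refine ⟨fun d => f₂ d + if d = (x, y') then θ else 0, ?_, ?_, ?_, ?_, ?_, ?_, hy'θ⟩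
    · intro e he'
      have : e ≠ (x, y') := fun h' => he' (h' ▸ he)
      simp [this, hf₂, h1 e he']
    · intro z
      rw [dplus_add_single, ← hp z, h2 z]
    · intro z
      rw [dminus_add_single]
      have := hm z
      rw [h3 z] at this
      by_cases hz : z = y
      · subst hz
        simp only [if_true, Ne.symm hyy, if_false, add_zero] at this ⊢
        exact ((ENNReal.add_left_inj ENNReal.coe_ne_top).mp this).symm
      · simp only [hz, if_false, add_zero] at this
        rw [this]
    · intro x'
      simp [hf₂, hyy, h5 y' hy']
    · intro z hz x'
      have hz1 : z ≠ y' := fun h' => hz (by simp [h'])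
      have hz2 : z ∉ S := fun h' => hz (by simp [h'])
      have hz3 : z ≠ y := fun h' => hz2 (h' ▸ h.mem)
      simp [hf₂, hz1, hz3, h5 z hz2]
    · intro z
      by_cases hz : z = y'
      · subst hz
        exact hy'θ.trans (by rw [two_mul]; exact le_self_add)
      · by_cases hzy : z = y
        · subst hzy
          refine (hcol z).trans ?_
          rw [two_mul]
          simpa [hz] using add_le_add_left h7 (θ : ℝ≥0∞)
        · refine (hcol z).trans ?_
          simpa [hz, hzy] using h6 z

/-- The state of the augmentation process started at `f₀`: a weighting `f` of the edges with row
capacities `w` and column capacities `c`, together with the amount `t` pushed out of `a`. -/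
structure IsAugState (E : Set (V × V)) (w c : V → ℝ≥0) (a : V) (k U : ℝ≥0∞)
    (f : V × V → ℝ≥0) (t : ℝ≥0) : Prop where
  supp : ∀ e, e ∉ E → f e = 0
  out_le : ∀ x, dplus f x ≤ w x
  in_le : ∀ y, dminus f y ≤ c y
  out_root : dplus f a ≤ k + t
  deficit : (∑' y, (c y - dminus f y)) + t ≤ U

/-- Comparison of states of the augmentation process. -/
def AugLE (p q : (V × V → ℝ≥0) × ℝ≥0) : Prop :=
  p.2 ≤ q.2 ∧ ∀ y, colDist p.1 q.1 y + 2 * p.2 ≤ 2 * q.2 ∧ dminus p.1 y ≤ dminus q.1 y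

lemma AugLE.refl (p : (V × V → ℝ≥0) × ℝ≥0) : AugLE p p :=
  ⟨le_rfl, fun y => ⟨by simp [colDist], le_rfl⟩⟩

lemma AugLE.trans {p q s : (V × V → ℝ≥0) × ℝ≥0} (h : AugLE p q) (h' : AugLE q s) : AugLE p s := by
  refine ⟨h.1.trans h'.1, fun y => ⟨?_, (h.2 y).2.trans (h'.2 y).2⟩⟩
  calc colDist p.1 s.1 y + 2 * p.2
      ≤ colDist p.1 q.1 y + colDist q.1 s.1 y + 2 * p.2 := by gcongr; exact colDist_triangle _ _ _ _
    _ = colDist q.1 s.1 y + (colDist p.1 q.1 y + 2 * p.2) := by ring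
    _ ≤ colDist q.1 s.1 y + 2 * q.2 := by gcongr; exact (h.2 y).1
    _ ≤ 2 * s.2 := (h'.2 y).1

open Filter Topology in
lemma colDist_le_of_tendsto {F : ℕ → V × V → ℝ≥0} {f g : V × V → ℝ≥0} {y : V} {K : ℝ≥0∞}
    (hF : ∀ e, Tendsto (fun n => F n e) atTop (𝓝 (f e))) (h : ∀ᶠ n in atTop, colDist g (F n) y ≤ K) :
    colDist g f y ≤ K := by
  refine ENNReal.tsum_eq_iSup_sum.trans_le (iSup_le fun s => ?_)
  refine le_of_tendsto (tendsto_finsetSum s fun x _ => tendsto_const_nhds.edist (hF (x, y)))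
    (h.mono fun n hn => (ENNReal.sum_le_tsum s).trans hn)

open Filter Topology in
lemma tsum_le_of_tendsto {F : ℕ → V → ℝ≥0} {f : V → ℝ≥0} {K : ℝ≥0∞}
    (hF : ∀ e, Tendsto (fun n => F n e) atTop (𝓝 (f e))) (h : ∀ n, ∑' e, (F n e : ℝ≥0∞) ≤ K) :
    ∑' e, (f e : ℝ≥0∞) ≤ K := by
  refine ENNReal.tsum_eq_iSup_sum.trans_le (iSup_le fun s => ?_)
  exact le_of_tendsto' (tendsto_finsetSum s fun x _ => ENNReal.tendsto_coe.mpr (hF x))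
    fun n => (ENNReal.sum_le_tsum s).trans (h n)

open Filter Topology in
/-- An increasing sequence of states has an upper bound. -/
lemma exists_augLE_bound {E : Set (V × V)} {w c : V → ℝ≥0} {a : V} {k U : ℝ≥0∞} (hU : U ≠ ⊤)
    (s : ℕ → (V × V → ℝ≥0) × ℝ≥0) (hs : ∀ n, IsAugState E w c a k U (s n).1 (s n).2)
    (hmono : ∀ m n, m ≤ n → AugLE (s m) (s n)) :
    ∃ b : (V × V → ℝ≥0) × ℝ≥0, IsAugState E w c a k U b.1 b.2 ∧ ∀ n, AugLE (s n) b := by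
  have htm : Monotone fun n => (s n).2 := fun m n h => (hmono m n h).1
  have htU : ∀ n, ((s n).2 : ℝ≥0∞) ≤ U := fun n => le_add_self.trans (hs n).deficit
  have hbdd : BddAbove (Set.range fun n => (s n).2) := by
    refine ⟨U.toNNReal, ?_⟩
    rintro _ ⟨n, rfl⟩
    exact ENNReal.le_toNNReal_of_coe_le (htU n) hU
  set t : ℝ≥0 := ⨆ n, (s n).2
  have ht : Tendsto (fun n => (s n).2) atTop (𝓝 t) := tendsto_atTop_ciSup htm hbdd
  have htle : ∀ n, (s n).2 ≤ t := fun n => le_ciSup hbdd n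
  have hcauchy : ∀ e : V × V, CauchySeq fun n => (s n).1 e := by
    rintro ⟨x, y⟩
    have hd : ∀ m n, m ≤ n → edist ((s m).1 (x, y)) ((s n).1 (x, y)) + 2 * (s m).2 ≤
        2 * (s n).2 := fun m n h =>
      le_trans (by gcongr; exact ENNReal.le_tsum (f := fun x => edist ((s m).1 (x, y)) _) x)
        ((hmono m n h).2 y).1
    have hd' : ∀ m n, m ≤ n → dist ((s m).1 (x, y)) ((s n).1 (x, y)) ≤
        2 * ((s n).2 : ℝ) - 2 * (s m).2 := by
      intro m n h
      have := hd m n h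
      rw [edist_nndist] at this
      have h2 : nndist ((s m).1 (x, y)) ((s n).1 (x, y)) + 2 * (s m).2 ≤ 2 * (s n).2 := by
        exact_mod_cast this
      have h3 : ((nndist ((s m).1 (x, y)) ((s n).1 (x, y)) + 2 * (s m).2 : ℝ≥0) : ℝ) ≤
        ((2 * (s n).2 : ℝ≥0) : ℝ) := by exact_mod_cast h2
      push_cast at h3
      linarith
    refine cauchySeq_of_le_tendsto_0' (fun n => 2 * (t : ℝ) - 2 * (s n).2) (fun m n h => ?_) ?_
    · have : ((s n).2 : ℝ) ≤ t := by exact_mod_cast htle n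
      linarith [hd' m n h]
    · have : Tendsto (fun n => ((s n).2 : ℝ)) atTop (𝓝 (t : ℝ)) := NNReal.tendsto_coe.mpr ht
      simpa using (this.const_mul 2).const_sub (2 * (t : ℝ))
  choose f hf using fun e => cauchySeq_tendsto_of_complete (hcauchy e)
  have hdist : ∀ n y, colDist (s n).1 f y + 2 * (s n).2 ≤ 2 * t := by
    intro n y
    have hle : ((2 * (s n).2 : ℝ≥0) : ℝ≥0∞) ≤ ((2 * t : ℝ≥0) : ℝ≥0∞) := by
      have := htle n
      gcongr
    have hfin : (2 * (s n).2 : ℝ≥0∞) ≠ ⊤ := by finiteness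
    rw [← ENNReal.le_sub_iff_add_le_right hfin (by exact_mod_cast hle)]
    refine colDist_le_of_tendsto hf ?_
    filter_upwards [eventually_ge_atTop n] with m hm
    rw [ENNReal.le_sub_iff_add_le_right hfin (by exact_mod_cast hle)]
    refine ((hmono n m hm).2 y).1.trans ?_
    have := htle m
    gcongr
  have hdm : ∀ n y, dminus (s n).1 y ≤ dminus f y := by
    intro n y
    have h1 : ∀ᶠ m in atTop, dminus (s n).1 y ≤ dminus f y + (2 * t - 2 * (s m).2) := by
      filter_upwards [eventually_ge_atTop n] with m hm
      refine ((hmono n m hm).2 y).2.trans ((dminus_le_add_colDist _ f y).trans ?_)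
      gcongr
      exact ENNReal.le_sub_of_add_le_right (by finiteness) (hdist m y)
    have h2 : Tendsto (fun m => dminus f y + (2 * (t : ℝ≥0∞) - 2 * ((s m).2 : ℝ≥0∞))) atTop
        (𝓝 (dminus f y + (2 * (t : ℝ≥0∞) - 2 * (t : ℝ≥0∞)))) := by
      refine tendsto_const_nhds.add (ENNReal.Tendsto.sub tendsto_const_nhds ?_ (by left; finiteness))
      exact ENNReal.Tendsto.const_mul (ENNReal.tendsto_coe.mpr ht) (by right; finiteness)
    rw [tsub_self, add_zero] at h2
    exact ge_of_tendsto h2 h1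
  refine ⟨(f, t), ⟨?_, ?_, ?_, ?_, ?_⟩, fun n => ⟨htle n, fun y => ⟨hdist n y, hdm n y⟩⟩⟩
  · intro e he
    have := hf e
    simp only [fun n => (hs n).supp e he] at this
    exact tendsto_nhds_unique this tendsto_const_nhds
  · exact fun x => tsum_le_of_tendsto (fun y => hf (x, y)) fun n => (hs n).out_le x
  · exact fun y => tsum_le_of_tendsto (fun x => hf (x, y)) fun n => (hs n).in_le y
  · refine tsum_le_of_tendsto (fun y => hf (a, y)) fun n => (hs n).out_root.trans ?_
    have := htle n
    gcongr
  · have h1 : Tendsto (fun n => (∑' y, (c y - dminus f y)) + ((s n).2 : ℝ≥0∞)) atTop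
        (𝓝 ((∑' y, (c y - dminus f y)) + t)) :=
      tendsto_const_nhds.add (ENNReal.tendsto_coe.mpr ht)
    refine le_of_tendsto' h1 fun n => le_trans ?_ (hs n).deficit
    gcongr with y
    exact hdm n y

/-- A state from which an unsaturated column vertex can be reached can be augmented. -/
lemma IsAugState.exists_lt {E : Set (V × V)} {w c : V → ℝ≥0} {a : V} {k U : ℝ≥0∞}
    (hkU : k + U ≤ w a) {f : V × V → ℝ≥0} {t : ℝ≥0} (hf : IsAugState E w c a k U f t)
    {S : Set V} {y : V} (hy : AltPath E f a S y) (hlt : dminus f y < c y) :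
    ∃ f' t', IsAugState E w c a k U f' t' ∧ AugLE (f, t) (f', t') ∧ t < t' := by
  obtain ⟨θ₀, hθ₀, H⟩ := hy.exists_augment hf.supp
  obtain ⟨θ, hθpos, hθle, hθc⟩ : ∃ θ : ℝ≥0, 0 < θ ∧ θ ≤ θ₀ ∧ dminus f y + θ ≤ c y := by
    have hfin : dminus f y ≠ ⊤ := hlt.ne_top
    lift dminus f y to ℝ≥0 using hfin with d
    have hd : d < c y := by exact_mod_cast hlt
    refine ⟨min θ₀ (c y - d), lt_min hθ₀ (tsub_pos_of_lt hd), min_le_left _ _, ?_⟩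
    have : d + min θ₀ (c y - d) ≤ c y :=
      (add_le_add_right (min_le_right _ _) d).trans (add_tsub_cancel_of_le hd.le).le
    exact_mod_cast this
  obtain ⟨f', h1, h2, h3, -, -, h6, -⟩ := H θ hθle
  have hdef : (∑' z, (c z - dminus f' z)) + ((t + θ : ℝ≥0) : ℝ≥0∞) ≤ U := by
    refine le_trans (le_of_eq ?_) hf.deficit
    rw [ENNReal.coe_add, add_comm (t : ℝ≥0∞), ← add_assoc]
    congr 1
    rw [← tsum_ite_eq y (fun _ => (θ : ℝ≥0∞)), ← ENNReal.tsum_add]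
    refine tsum_congr fun z => ?_
    rw [h3 z]
    split_ifs with hz
    · subst hz
      rw [← tsub_tsub, tsub_add_cancel_of_le]
      exact ENNReal.le_sub_of_add_le_left hlt.ne_top hθc
    · simp
  have hroot : dplus f' a ≤ k + ((t + θ : ℝ≥0) : ℝ≥0∞) := by
    rw [h2 a, if_pos rfl, ENNReal.coe_add, ← add_assoc]
    gcongr
    exact hf.out_root
  refine ⟨f', t + θ, ⟨h1, fun x => ?_, fun z => ?_, hroot, hdef⟩, ⟨le_self_add, fun z => ⟨?_, ?_⟩⟩,
    lt_add_of_pos_right t hθpos⟩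
  · by_cases hx : x = a
    · subst hx
      refine hroot.trans (le_trans ?_ hkU)
      gcongr
      exact le_add_self.trans hdef
    · simpa [h2 x, hx] using hf.out_le x
  · by_cases hz : z = y
    · subst hz
      simpa [h3 z] using hθc
    · simpa [h3 z, hz] using hf.in_le z
  · rw [ENNReal.coe_add, mul_add, add_comm]
    gcongr
    exact h6 z
  · rw [h3 z]
    exact le_self_add

/-- If every column of `f₀` misses its capacity by at most `u`, and the row `a` misses its capacity
by more than `∑ u`, then `f₀` can be augmented from `a` until all columns reachable from `a` are
saturated. -/
lemma exists_saturating_augmentation (E : Set (V × V)) (w c u : V → ℝ≥0) (a : V)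
    (hU : (∑' v, (u v : ℝ≥0∞)) ≠ ⊤) (f₀ : V × V → ℝ≥0) (hsupp : ∀ e, e ∉ E → f₀ e = 0)
    (hout : ∀ x, dplus f₀ x ≤ w x) (hin : ∀ y, dminus f₀ y ≤ c y)
    (hu : ∀ y, (c y : ℝ≥0∞) ≤ dminus f₀ y + u y)
    (hslack : dplus f₀ a + ∑' v, (u v : ℝ≥0∞) < w a) :
    ∃ (f : V × V → ℝ≥0) (R : Set V), (∀ e, e ∉ E → f e = 0) ∧ (∀ x, dplus f x ≤ w x) ∧
      dplus f a < w a ∧ (∀ y, (a, y) ∈ E → y ∈ R) ∧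
      (∀ x y y', y ∈ R → f (x, y) ≠ 0 → (x, y') ∈ E → y' ∈ R) ∧
      (∀ y ∈ R, dminus f y = c y ∧ ∃ x, (x, y) ∈ E) ∧ ∀ y, dminus f y ≤ c y := by
  set U := ∑' v, (u v : ℝ≥0∞)
  let X := {p : (V × V → ℝ≥0) × ℝ≥0 // IsAugState E w c a (dplus f₀ a) U p.1 p.2}
  have h₀ : IsAugState E w c a (dplus f₀ a) U f₀ 0 := by
    refine ⟨hsupp, hout, hin, by simp, ?_⟩
    rw [ENNReal.coe_zero, add_zero]
    exact ENNReal.tsum_le_tsum fun y => tsub_le_iff_left.mpr (hu y)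
  have htU : ∀ x : X, (x.1.2 : ℝ≥0∞) ≤ U := fun x => le_add_self.trans x.2.deficit
  obtain ⟨⟨⟨f, t⟩, hf⟩, hmax⟩ := exists_stable_of_seq_bounded (fun p q : X => AugLE p.1 q.1)
    (fun x => AugLE.refl _) (fun _ _ _ => AugLE.trans) (fun x => (x.1.2 : ℝ))
    (fun _ _ h => NNReal.coe_le_coe.mpr h.1) (U.toNNReal : ℝ)
    (fun x => NNReal.coe_le_coe.mpr (ENNReal.le_toNNReal_of_coe_le (htU x) hU))
    (fun s hs => by
      obtain ⟨b, hb, hb'⟩ := exists_augLE_bound hU (fun n => (s n).1) (fun n => (s n).2) hs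
      exact ⟨⟨b, hb⟩, hb'⟩) ⟨(f₀, 0), h₀⟩
  refine ⟨f, {y | ∃ S, AltPath E f a S y}, hf.supp, hf.out_le, ?_, fun y hy => ⟨_, .base hy⟩, ?_, ?_,
    hf.in_le⟩
  · refine hf.out_root.trans_lt (lt_of_le_of_lt ?_ hslack)
    gcongr
    exact htU ⟨(f, t), hf⟩
  · rintro x y y' ⟨S, hS⟩ hxy he
    exact hS.exists_extend hxy he
  · rintro y ⟨S, hS⟩
    refine ⟨(hf.in_le y).antisymm (not_lt.mp fun hlt => ?_), hS.exists_edge⟩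
    obtain ⟨f', t', h1, h2, h3⟩ := hf.exists_lt hslack.le hS hlt
    have := hmax ⟨(f', t'), h1⟩ h2
    exact absurd (NNReal.coe_le_coe.mp this) (not_le.mpr h3)

lemma dplus_ne_zero_iff {f : V × V → ℝ≥0} {x : V} : dplus f x ≠ 0 ↔ ∃ y, f (x, y) ≠ 0 := by
  simp [dplus, ENNReal.tsum_eq_zero]

lemma dminus_eq_zero_iff {f : V × V → ℝ≥0} {y : V} : dminus f y = 0 ↔ ∀ x, f (x, y) = 0 := by
  simp [dminus, ENNReal.tsum_eq_zero]

/-- A path to `B` starting outside `B` has a first edge. -/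
lemma IsABPath.exists_second {E : Set (V × V)} {A B : Set V} {p : List V} (hp : IsABPath E A B p) :
    ∃ x ∈ A, x ∈ p ∧ (x ∉ B → ∃ y ∈ p, (x, y) ∈ E) := by
  obtain ⟨hw, ⟨x, hx, hhead⟩, ⟨b, hb, hlast⟩⟩ := hp
  match p, hw, hhead, hlast with
  | [z], _, hhead, hlast =>
    simp at hhead hlast
    subst hhead hlast
    exact ⟨z, hx, by simp, fun h => absurd hb h⟩
  | z :: y :: l, hw, hhead, _ =>
    simp at hhead
    subst hhead
    refine ⟨z, hx, by simp, fun _ => ⟨y, by simp, ?_⟩⟩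
    exact (List.isChain_cons_cons.mp hw).1

lemma isABPath_pair {E : Set (V × V)} {B : Set V} {x y : V} (h : (x, y) ∈ E) (hy : y ∈ B) :
    IsABPath E {x} B [x, y] :=
  ⟨List.isChain_pair.mpr h, ⟨x, rfl, rfl⟩, ⟨y, hy, rfl⟩⟩

theorem stmt12 (W : Web V) (hbip : Bipartite W) (u : V → ℝ≥0)
    (hsupp : ∀ v, v ∉ W.B → u v = 0) (hle : ∀ v, u v ≤ W.w v)
    (hfin : (∑' v, (u v : ℝ≥0∞)) ≠ ⊤)
    (g : V × V → ℝ≥0) (a : V)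
    (hgw : IsWave {W with w := fun v => W.w v - u v} g)
    (ha : a ∈ W.A)
    (hae : a ∉ Essential {W with w := fun v => W.w v - u v}
      (TER {W with w := fun v => W.w v - u v} g))
    (hhind : dplus g a + (∑' v, (u v : ℝ≥0∞)) < ((W.w a - u a : ℝ≥0) : ℝ≥0∞)) :
    Hindered W := by

  set W' : Web V := {W with w := fun v => W.w v - u v} with hW'
  set T := TER W' g
  obtain ⟨hcur, hsep, hroof⟩ := hgw
  have hAB : ∀ x ∈ W.A, x ∈ W.B → x ∈ T := fun x hx hb => ⟨Or.inl hx, hcur.b_out x hb⟩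
  have haB : a ∉ W.B := by
    intro hb
    refine hae ⟨hAB a ha hb, [a], ⟨List.isChain_singleton a, ⟨a, rfl, rfl⟩, ⟨a, hb, rfl⟩⟩, ?_⟩
    simp
  have hNa : ∀ y, (a, y) ∈ W.D → y ∈ T := by
    intro y hay
    have hyB := (hbip.2 _ hay).2
    by_contra hyT
    have hpath := isABPath_pair hay hyB
    by_cases haT : a ∈ T
    · refine hae ⟨haT, [a, y], hpath, ?_⟩
      intro z hz hzT
      simp only [List.mem_cons, List.not_mem_nil, or_false] at hz
      rcases hz with rfl | rfl
      · rfl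
      · exact absurd hzT hyT
    · obtain ⟨z, hzT, hz⟩ := hsep [a, y] ⟨hpath.1, ⟨a, ha, rfl⟩, hpath.2.2⟩
      simp only [List.mem_cons, List.not_mem_nil, or_false] at hz
      rcases hz with rfl | rfl
      exacts [haT hzT, hyT hzT]
  let E : Set (V × V) := {e | e ∈ W.D ∧ e.1 ∉ W.B ∧ e.2 ∉ W.A ∧ ∀ y, (e.1, y) ∈ W.D → y ∈ T}
  have hgE : ∀ e, e ∉ E → g e = 0 := by
    rintro ⟨x, y⟩ he
    by_contra hne
    have hx : dplus g x ≠ 0 := dplus_ne_zero_iff.mpr ⟨y, hne⟩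
    refine he ⟨not_not.mp fun h => hne (hcur.supp _ h), fun hb => hx (hcur.b_out x hb),
      fun hyA => hne (dminus_eq_zero_iff.mp (hcur.a_in y hyA) x), fun y' hy' => ?_⟩
    have hxr : x ∈ RF W' T := not_not.mp fun h => hx (hroof x h)
    obtain ⟨z, hzT, hz⟩ := hxr [x, y'] (isABPath_pair hy' (hbip.2 _ hy').2)
    simp only [List.mem_cons, List.not_mem_nil, or_false] at hz
    rcases hz with rfl | rfl
    exacts [absurd hzT.2 hx, hzT]
  let c : V → ℝ≥0 := fun y => if ∃ x, (x, y) ∈ E then W.w y else 0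
  have hsat : ∀ y, (∃ x, (x, y) ∈ E) → dminus g y = ((W.w y - u y : ℝ≥0) : ℝ≥0∞) := by
    rintro y ⟨x, hx⟩
    exact ((hx.2.2.2 y hx.1).1).resolve_left hx.2.2.1
  have hw' : ∀ x, ((W.w x - u x : ℝ≥0) : ℝ≥0∞) ≤ W.w x := fun x => by exact_mod_cast tsub_le_self
  obtain ⟨f, R, hfE, hfout, hfa, hRa, hRstep, hRsat, hfin'⟩ :=
    exists_saturating_augmentation E W.w c u a hfin g hgE (fun x => (hcur.out_le x).trans (hw' x))
      (fun y => by
        by_cases h : ∃ x, (x, y) ∈ E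
        · simp only [c, if_pos h]
          exact (hcur.in_le y).trans (hw' y)
        · rw [dminus_eq_zero_iff.mpr fun x => hgE _ fun he => h ⟨x, he⟩]
          exact zero_le)
      (fun y => by
        by_cases h : ∃ x, (x, y) ∈ E
        · simp only [c, if_pos h]
          rw [hsat y h, ← ENNReal.coe_add, tsub_add_cancel_of_le (hle y)]
        · simp [c, if_neg h])
      (hhind.trans_le (hw' a))
  let f' : V × V → ℝ≥0 := fun e => if e.2 ∈ R then f e else 0
  have hf'f : ∀ e, f' e ≤ f e := fun e => by simp only [f']; split_ifs <;> simp
  have hf'E : ∀ e, e ∉ E → f' e = 0 := fun e he =>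
    nonpos_iff_eq_zero.mp ((hf'f e).trans (hfE e he).le)
  have hplus : ∀ x, dplus f' x ≤ dplus f x := fun x =>
    ENNReal.tsum_le_tsum fun y => ENNReal.coe_le_coe.mpr (hf'f _)
  have hminus : ∀ x, dminus f' x ≤ dminus f x := fun x =>
    ENNReal.tsum_le_tsum fun y => ENNReal.coe_le_coe.mpr (hf'f _)
  have hcw : ∀ y, c y ≤ W.w y := fun y => by simp only [c]; split_ifs <;> simp
  have hb_out : ∀ b ∈ W.B, dplus f' b = 0 := fun b hb => by
    by_contra h
    obtain ⟨y, hy⟩ := dplus_ne_zero_iff.mp h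
    exact hy (hf'E _ fun he => he.2.1 hb)
  have hcur' : IsCurrent W f' := by
    refine ⟨fun e he => hf'E e fun h => he h.1, fun x => (hplus x).trans (hfout x),
      fun x => (hminus x).trans ((hfin' x).trans (ENNReal.coe_le_coe.mpr (hcw x))), fun x hx => ?_,
      fun x hx => dminus_eq_zero_iff.mpr fun z => hf'E _ fun he => he.2.2.1 hx, hb_out⟩
    rw [hb_out x ((hbip.1 x).resolve_left hx)]
    exact zero_le
  have hRT : ∀ y ∈ R, y ∈ TER W f' := by
    intro y hy
    obtain ⟨h1, x, hx⟩ := hRsat y hy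
    refine ⟨Or.inr ?_, hb_out y (hbip.2 _ hx.1).2⟩
    have : dminus f' y = dminus f y := by simp [dminus, f', hy]
    rw [this, h1]
    simp only [c, if_pos (⟨x, hx⟩ : ∃ x, (x, y) ∈ E)]
  have hABT : ∀ x ∈ W.A, x ∈ W.B → x ∈ TER W f' := fun x hx hb => ⟨Or.inl hx, hb_out x hb⟩
  have hnbr : ∀ x, dplus f' x ≠ 0 → x ∉ W.B ∧ ∀ y, (x, y) ∈ W.D → y ∈ TER W f' := by
    intro x hx
    obtain ⟨z, hz⟩ := dplus_ne_zero_iff.mp hx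
    have hzR : z ∈ R := not_not.mp fun h => hz (by simp [f', h])
    have hfz : f (x, z) ≠ 0 := by simpa [f', hzR] using hz
    have hE : (x, z) ∈ E := not_not.mp fun h => hfz (hfE _ h)
    refine ⟨hE.2.1, fun y hy => ?_⟩
    by_cases hyA : y ∈ W.A
    · exact hABT y hyA (hbip.2 _ hy).2
    · exact hRT y (hRstep x z y hzR hfz ⟨hy, hE.2.1, hyA, hE.2.2.2⟩)
  refine ⟨f', ⟨hcur', ?_, ?_⟩, a, ha, ?_, (hplus a).trans_lt hfa⟩
  · intro p hp
    obtain ⟨x, hxA, hxp, hnext⟩ := hp.exists_second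
    by_cases hx : dplus f' x = 0
    · exact ⟨x, ⟨Or.inl hxA, hx⟩, hxp⟩
    · obtain ⟨hxB, hN⟩ := hnbr x hx
      obtain ⟨y, hyp, hxy⟩ := hnext hxB
      exact ⟨y, hN y hxy, hyp⟩
  · intro x hxr
    by_contra hx
    obtain ⟨hxB, hN⟩ := hnbr x hx
    refine hxr fun p hp => ?_
    obtain ⟨_, rfl, -, hnext⟩ := hp.exists_second
    obtain ⟨y, hyp, hxy⟩ := hnext hxB
    exact ⟨y, hN y hxy, hyp⟩
  · rintro ⟨-, p, hp, hpT⟩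
    obtain ⟨_, rfl, -, hnext⟩ := hp.exists_second
    obtain ⟨y, hyp, hay⟩ := hnext haB
    have hyB := (hbip.2 _ hay).2
    have hyT : y ∈ TER W f' := by
      by_cases hyA : y ∈ W.A
      · exact hABT y hyA hyB
      · exact hRT y (hRa y ⟨hay, haB, hyA, hNa⟩)
    exact haB (hpT y hyp hyT ▸ hyB)
end
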